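/- arXiv:1108.0499 — 2 statements merged into one kernel-verified Lean document; each statement's English description precedes it below -/
import Mathlib

section
/- Let n ≥ 1, 1 ≤ p < ∞, 0 < T ≤ ∞, let i ≥ 1 be an integer and let α satisfy 2i < α < 2i+2. There exist constants c, C > 0 (depending only on n, p, α, i, T) such that for every Schwartz function f on ℝ^{n+1} (restricted to ℝⁿ×(0,T)): c·‖f‖_{B^{α,α/2}_p(ℝⁿ_T)} ≤ ‖f‖_{B^{α−2,(α−2)/2}_p(ℝⁿ_T)} + Σ_{k=1}^n ‖∂_{X_k}f‖_{B^{α−2,(α−2)/2}_p(ℝⁿ_T)} + Σ_{k,j=1}^n ‖∂_{X_k}∂_{X_j}f‖_{B^{α−2,(α−2)/2}_p(ℝⁿ_T)} + ‖∂_t f‖_{B^{α−2,(α−2)/2}_p(ℝⁿ_T)} ≤ C·‖f‖_{B^{α,α/2}_p(ℝⁿ_T)}, where the B^{α,α/2}_p(ℝⁿ_T) norm is formed with index i and the B^{α−2,(α−2)/2}_p(ℝⁿ_T) norm with index i−1. -/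
noncomputable section

open MeasureTheory Real Complex
open scoped ENNReal NNReal Real BigOperators

/-- Euclidean space `ℝⁿ`. -/
abbrev Rn (n : ℕ) : Type := EuclideanSpace ℝ (Fin n)

/-- The space `ℝ^{n+1} = ℝⁿ × ℝ`, points written `(X, t)`. -/
abbrev Rn1 (n : ℕ) : Type := EuclideanSpace ℝ (Fin n) × ℝ

/-- Fourier transform on `ℝ^{n+1}`:
`𝓕f(ξ,τ) = ∫ e^{−2πi(X·ξ + tτ)} f(X,t) dX dt`. -/
def FT1 {n : ℕ} (f : Rn1 n → ℂ) (q : Rn1 n) : ℂ :=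
  ∫ p : Rn1 n,
    Complex.exp (-(2 * (π : ℂ) * Complex.I) *
      (((∑ k, p.1 k * q.1 k) + p.2 * q.2 : ℝ) : ℂ)) * f p

/-- Inverse Fourier transform on `ℝ^{n+1}`. -/
def IFT1 {n : ℕ} (f : Rn1 n → ℂ) (x : Rn1 n) : ℂ :=
  ∫ q : Rn1 n,
    Complex.exp ((2 * (π : ℂ) * Complex.I) *
      (((∑ k, q.1 k * x.1 k) + q.2 * x.2 : ℝ) : ℂ)) * f q

/-- The Fourier multiplier operator `f ↦ 𝓕⁻¹(m · 𝓕 f)` on `ℝ^{n+1}`. -/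
def MOp {n : ℕ} (m : Rn1 n → ℂ) (f : Rn1 n → ℂ) : Rn1 n → ℂ :=
  IFT1 (fun q => m q * FT1 f q)

/-- The symbol `m_α(ξ,τ) = (1 + 4π²|ξ|² + iτ)^{α/2}` (principal branch). -/
def mSym {n : ℕ} (α : ℝ) (q : Rn1 n) : ℂ :=
  (1 + 4 * (π : ℂ) ^ 2 * (‖q.1‖ : ℂ) ^ 2 + Complex.I * (q.2 : ℂ)) ^ ((α : ℂ) / 2)

/-- Partial derivative `∂_{X_k}`. -/
def dX {n : ℕ} (k : Fin n) (f : Rn1 n → ℂ) : Rn1 n → ℂ :=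
  fun x => fderiv ℝ f x (EuclideanSpace.single k 1, 0)

/-- Partial derivative `∂_t`. -/
def dT {n : ℕ} (f : Rn1 n → ℂ) : Rn1 n → ℂ :=
  fun x => fderiv ℝ f x (0, 1)

/-- Iterated spatial derivative `D_X^β` for a multi-index `β`. -/
def dXmulti {n : ℕ} (β : Fin n → ℕ) (f : Rn1 n → ℂ) : Rn1 n → ℂ :=
  (List.finRange n).foldr (fun k g => (dX k)^[β k] g) f

/-- The half time-derivative `D_t^{1/2} f = 𝓕⁻¹(|τ|^{1/2}·𝓕f)`. -/
def halfDt {n : ℕ} (f : Rn1 n → ℂ) : Rn1 n → ℂ :=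
  MOp (fun q => ((|q.2| ^ ((1 : ℝ) / 2) : ℝ) : ℂ)) f

/-- The `Lᵖ(ℝ^{n+1})` norm (as a value in `ℝ≥0∞`), `p` a real exponent. -/
def pNorm {n : ℕ} (p : ℝ) (f : Rn1 n → ℂ) : ℝ≥0∞ :=
  eLpNorm f (ENNReal.ofReal p) volume

/-- Multi-indices `β ∈ ℕⁿ` with `|β| = N`. -/
def multiIdx (n N : ℕ) : Finset (Fin n → ℕ) :=
  (Fintype.piFinset fun _ : Fin n => Finset.range (N + 1)).filter fun β => (∑ k, β k) = N

/-- Convolution on `ℝ^{n+1}`. -/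
def conv1 {n : ℕ} (g f : Rn1 n → ℂ) : Rn1 n → ℂ :=
  fun x => ∫ y : Rn1 n, g (x - y) * f y

/-- A parabolic Littlewood–Paley family on `ℝ^{n+1}`. -/
structure ParabolicLP (n : ℕ) where
  φ : SchwartzMap (Rn1 n) ℂ
  ψ : SchwartzMap (Rn1 n) ℂ
  ft_pos : ∀ q : Rn1 n,
    1 / 2 < ‖q.1‖ + |q.2| ^ ((1 : ℝ) / 2) → ‖q.1‖ + |q.2| ^ ((1 : ℝ) / 2) < 2 →
      0 < (FT1 (⇑φ) q).re ∧ (FT1 (⇑φ) q).im = 0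
  ft_supp : ∀ q : Rn1 n,
    ¬(1 / 2 < ‖q.1‖ + |q.2| ^ ((1 : ℝ) / 2) ∧ ‖q.1‖ + |q.2| ^ ((1 : ℝ) / 2) < 2) →
      FT1 (⇑φ) q = 0
  ft_sum : ∀ q : Rn1 n, q ≠ 0 →
    ∑' i : ℤ, FT1 (⇑φ) (((2 : ℝ) ^ (-i)) • q.1, ((2 : ℝ) ^ (-(2 * i))) * q.2) = 1
  ft_psi : ∀ q : Rn1 n,
    FT1 (⇑ψ) q =
      1 - ∑' i : ℕ,
        FT1 (⇑φ) (((2 : ℝ) ^ (-((i : ℤ) + 1))) • q.1, ((2 : ℝ) ^ (-(2 * ((i : ℤ) + 1)))) * q.2)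

/-- The dilate `φ_i`, whose Fourier transform is `𝓕φ(2^{−i}ξ, 2^{−2i}τ)`. -/
def lpPhi {n : ℕ} (P : ParabolicLP n) (i : ℕ) : Rn1 n → ℂ :=
  fun x => (((2 : ℝ) ^ (i * (n + 2)) : ℝ) : ℂ) *
    P.φ (((2 : ℝ) ^ i) • x.1, ((2 : ℝ) ^ (2 * i)) * x.2)

/-- Parabolic Besov norm `N_{s,p}(f)` on `ℝ^{n+1}`, `1 ≤ p < ∞`. -/
def pBesov {n : ℕ} (P : ParabolicLP n) (s p : ℝ) (f : Rn1 n → ℂ) : ℝ≥0∞ :=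
  eLpNorm (conv1 (⇑P.ψ) f) (ENNReal.ofReal p) volume +
  (∑' i : ℕ,
    (ENNReal.ofReal ((2 : ℝ) ^ (s * ((i : ℝ) + 1))) *
      eLpNorm (conv1 (lpPhi P (i + 1)) f) (ENNReal.ofReal p) volume) ^ p) ^ (1 / p)

/-- Parabolic Besov norm `N_{s,∞}(f)` on `ℝ^{n+1}`. -/
def pBesovInf {n : ℕ} (P : ParabolicLP n) (s : ℝ) (f : Rn1 n → ℂ) : ℝ≥0∞ :=
  max (eLpNorm (conv1 (⇑P.ψ) f) ⊤ volume)
    (⨆ i : ℕ, ENNReal.ofReal ((2 : ℝ) ^ (s * ((i : ℝ) + 1))) *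
      eLpNorm (conv1 (lpPhi P (i + 1)) f) ⊤ volume)

/-- The time interval `(0, T)` for `0 < T ≤ ∞`. -/
def tSet (T : ℝ≥0∞) : Set ℝ := {t : ℝ | 0 < t ∧ ENNReal.ofReal t < T}

/-- Lebesgue measure restricted to the strip `ℝⁿ × (0,T)`. -/
def stripMeasure (n : ℕ) (T : ℝ≥0∞) : Measure (Rn1 n) :=
  volume.restrict {x : Rn1 n | x.2 ∈ tSet T}

/-- The parabolic Sobolev norm `‖g‖_{W^{2i,i}_p(ℝⁿ_T)}`. -/
def wNorm {n : ℕ} (i : ℕ) (p : ℝ) (T : ℝ≥0∞) (g : Rn1 n → ℂ) : ℝ≥0∞ :=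
  ∑ l ∈ Finset.range (i + 1),
    ∑ β ∈ (Fintype.piFinset fun _ : Fin n => Finset.range (2 * i + 1)).filter
        (fun β => (∑ k, β k) + 2 * l ≤ 2 * i),
      eLpNorm (dXmulti β (dT^[l] g)) (ENNReal.ofReal p) (stripMeasure n T)

/-- Time-regularity seminorm `[g]_{t,β,p,T}`. -/
def semT {n : ℕ} (b p : ℝ) (T : ℝ≥0∞) (g : Rn1 n → ℂ) : ℝ≥0∞ :=
  (∫⁻ X : Rn n, ∫⁻ t in tSet T, ∫⁻ s in tSet T,
      ENNReal.ofReal (‖g (X, t) - g (X, s)‖ ^ p / |t - s| ^ (1 + p * b / 2))) ^ (1 / p)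

/-- Space-regularity seminorm `[g]_{x,β,p,T}`. -/
def semX {n : ℕ} (b p : ℝ) (T : ℝ≥0∞) (g : Rn1 n → ℂ) : ℝ≥0∞ :=
  (∫⁻ t in tSet T, ∫⁻ X : Rn n, ∫⁻ Y : Rn n,
      ENNReal.ofReal (‖g (X + Y, t) - 2 * g (X, t) + g (X - Y, t)‖ ^ p /
        ‖Y‖ ^ ((n : ℝ) + p * b))) ^ (1 / p)

/-- The parabolic Besov norm `‖g‖_{B^{α,α/2}_p(ℝⁿ_T)}`, formed with index `i` where
`2i < α < 2i+2`. -/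
def pbNorm {n : ℕ} (i : ℕ) (α p : ℝ) (T : ℝ≥0∞) (g : Rn1 n → ℂ) : ℝ≥0∞ :=
  wNorm i p T g +
  ∑ l ∈ Finset.range (i + 1),
    ∑ β ∈ (Fintype.piFinset fun _ : Fin n => Finset.range (2 * i + 1)).filter
        (fun β => (∑ k, β k) + 2 * l = 2 * i),
      (semT (α - 2 * i) p T (dXmulti β (dT^[l] g)) +
        semX (α - 2 * i) p T (dXmulti β (dT^[l] g)))

/-- Fourier transform on `ℝⁿ`. -/
def FTn {n : ℕ} (f : Rn n → ℂ) (ξ : Rn n) : ℂ :=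
  ∫ x : Rn n, Complex.exp (-(2 * (π : ℂ) * Complex.I) * (((∑ k, x k * ξ k : ℝ)) : ℂ)) * f x

/-- Inverse Fourier transform on `ℝⁿ`. -/
def IFTn {n : ℕ} (f : Rn n → ℂ) (x : Rn n) : ℂ :=
  ∫ ξ : Rn n, Complex.exp ((2 * (π : ℂ) * Complex.I) * (((∑ k, ξ k * x k : ℝ)) : ℂ)) * f ξ

/-- Convolution on `ℝⁿ`. -/
def convn {n : ℕ} (g f : Rn n → ℂ) : Rn n → ℂ := fun x => ∫ y : Rn n, g (x - y) * f y

/-- A Littlewood–Paley family on `ℝⁿ`. -/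
structure LPFamily (n : ℕ) where
  φ : SchwartzMap (Rn n) ℂ
  ψ : SchwartzMap (Rn n) ℂ
  ft_pos : ∀ ξ : Rn n, 1 / 2 < ‖ξ‖ → ‖ξ‖ < 2 →
    0 < (FTn (⇑φ) ξ).re ∧ (FTn (⇑φ) ξ).im = 0
  ft_supp : ∀ ξ : Rn n, ¬(1 / 2 < ‖ξ‖ ∧ ‖ξ‖ < 2) → FTn (⇑φ) ξ = 0
  ft_sum : ∀ ξ : Rn n, ξ ≠ 0 → ∑' i : ℤ, FTn (⇑φ) (((2 : ℝ) ^ (-i)) • ξ) = 1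
  ft_psi : ∀ ξ : Rn n,
    FTn (⇑ψ) ξ = 1 - ∑' i : ℕ, FTn (⇑φ) (((2 : ℝ) ^ (-((i : ℤ) + 1))) • ξ)

/-- The dilate `φ′_i(x) = 2^{in} φ′(2^i x)`. -/
def lpPhin {n : ℕ} (P : LPFamily n) (i : ℕ) : Rn n → ℂ :=
  fun x => (((2 : ℝ) ^ (i * n) : ℝ) : ℂ) * P.φ (((2 : ℝ) ^ i) • x)

/-- Besov norm `B_{s,p}(f)` on `ℝⁿ`, `1 ≤ p < ∞`. -/
def besovN {n : ℕ} (P : LPFamily n) (s p : ℝ) (f : Rn n → ℂ) : ℝ≥0∞ :=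
  eLpNorm (convn (⇑P.ψ) f) (ENNReal.ofReal p) volume +
  (∑' i : ℕ,
    (ENNReal.ofReal ((2 : ℝ) ^ (s * ((i : ℝ) + 1))) *
      eLpNorm (convn (lpPhin P (i + 1)) f) (ENNReal.ofReal p) volume) ^ p) ^ (1 / p)

/-- The heat kernel `Γ(X,t)` on `ℝⁿ` (zero for `t ≤ 0`). -/
def heatKer (n : ℕ) (X : Rn n) (t : ℝ) : ℝ :=
  if 0 < t then (4 * π * t) ^ (-(n : ℝ) / 2) * Real.exp (-‖X‖ ^ 2 / (4 * t)) else 0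

/-- The heat extension `u(X,t) = ∫ Γ(X−Y,t) f(Y) dY`. -/
def heatExt {n : ℕ} (f : Rn n → ℂ) : Rn1 n → ℂ :=
  fun x => ∫ Y : Rn n, (heatKer n (x.1 - Y) x.2 : ℂ) * f Y

section Slices

variable {E : Type*} [NormedAddCommGroup E] [NormedSpace ℝ E]

lemma hasDerivAt_of_hasLineDerivAt {u v : E → ℂ} {e : E}
    (h : ∀ x, HasLineDerivAt ℝ u (v x) x e) (x : E) (s : ℝ) :
    HasDerivAt (fun t : ℝ => u (x + t • e)) (v (x + s • e)) s := by
  have h1 := h (x + s • e)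
  unfold HasLineDerivAt at h1
  have h2 : HasDerivAt (fun t : ℝ => t - s) 1 s := (hasDerivAt_id s).sub_const s
  have h3 := HasDerivAt.scomp_of_eq (h := fun t : ℝ => t - s) s h1 h2 (by simp)
  simp only [one_smul] at h3
  refine h3.congr_of_eventuallyEq (Filter.Eventually.of_forall fun t => ?_)
  simp only [Function.comp, add_assoc, ← add_smul]
  congr 3
  ring

lemma hasLineDerivAt_sub_translate {u v : E → ℂ} {e : E}
    (h : ∀ x, HasLineDerivAt ℝ u (v x) x e) (y x : E) :
    HasLineDerivAt ℝ (fun x => u x - u (x - y)) (v x - v (x - y)) x e := by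
  have h2 := h (x - y)
  unfold HasLineDerivAt at h2 ⊢
  refine (h x).sub (h2.congr_of_eventuallyEq (Filter.Eventually.of_forall fun t => ?_))
  simp only [sub_add_eq_add_sub]

/-- Jensen's inequality for the power `p ≥ 1` on a probability space. -/
lemma lintegral_rpow_le_of_isProbabilityMeasure {α : Type*} [MeasurableSpace α] {μ : Measure α}
    [IsProbabilityMeasure μ] {p : ℝ} (hp : 1 ≤ p) {f : α → ℝ≥0∞} (hf : AEMeasurable f μ) :
    (∫⁻ x, f x ∂μ) ^ p ≤ ∫⁻ x, f x ^ p ∂μ := by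
  have h := eLpNorm'_le_eLpNorm'_of_exponent_le (f := f) one_pos hp μ hf.aestronglyMeasurable
  simp only [eLpNorm', enorm_eq_self, ENNReal.rpow_one, div_one] at h
  rwa [one_div, ENNReal.le_rpow_inv_iff (by linarith)] at h

instance isProbabilityMeasure_restrict_Ioc :
    IsProbabilityMeasure ((volume : Measure ℝ).restrict (Set.Ioc 0 1)) := ⟨by simp⟩

lemma enorm_sub_le_lintegral_of_hasLineDerivAt {u v : E → ℂ} (hv : Continuous v) {e : E}
    (h : ∀ x, HasLineDerivAt ℝ u (v x) x e) (x : E) :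
    ‖u (x + e) - u x‖ₑ ≤ ∫⁻ s in Set.Ioc (0 : ℝ) 1, ‖v (x + s • e)‖ₑ := by
  have h1 : ∫ s in (0 : ℝ)..1, v (x + s • e) = u (x + (1 : ℝ) • e) - u (x + (0 : ℝ) • e) :=
    intervalIntegral.integral_eq_sub_of_hasDerivAt
      (fun s _ => hasDerivAt_of_hasLineDerivAt h x s)
      (Continuous.intervalIntegrable (by fun_prop) _ _)
  rw [one_smul, zero_smul, add_zero, intervalIntegral.integral_of_le zero_le_one] at h1
  rw [← h1]
  exact enorm_integral_le_lintegral_enorm _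

lemma enorm_sub_rpow_le_lintegral_of_hasLineDerivAt {p : ℝ} (hp : 1 ≤ p) {u v : E → ℂ}
    (hv : Continuous v) {e : E} (h : ∀ x, HasLineDerivAt ℝ u (v x) x e) (x : E) :
    ‖u (x + e) - u x‖ₑ ^ p ≤ ∫⁻ s in Set.Ioc (0 : ℝ) 1, ‖v (x + s • e)‖ₑ ^ p := by
  refine (ENNReal.rpow_le_rpow (enorm_sub_le_lintegral_of_hasLineDerivAt hv h x)
    (by linarith)).trans ?_
  exact lintegral_rpow_le_of_isProbabilityMeasure hp
    (by apply Continuous.aemeasurable; fun_prop)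

variable [MeasurableSpace E] [BorelSpace E] [SecondCountableTopology E] {μ : Measure E} [SFinite μ]
  [μ.IsAddRightInvariant]

lemma lintegral_enorm_sub_rpow_le {p : ℝ} (hp : 1 ≤ p) {I : Set E} (hI : Convex ℝ I)
    (hIm : MeasurableSet I) {u v : E → ℂ} (hv : Continuous v) {e : E}
    (h : ∀ x, HasLineDerivAt ℝ u (v x) x e) :
    ∫⁻ x, I.indicator 1 x * I.indicator 1 (x + e) * ‖u (x + e) - u x‖ₑ ^ p ∂μ ≤
      ∫⁻ x in I, ‖v x‖ₑ ^ p ∂μ := by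
  have hmeas : Measurable (fun x => I.indicator 1 x * ‖v x‖ₑ ^ p) := by
    have : Measurable (I.indicator (1 : E → ℝ≥0∞)) := measurable_one.indicator hIm
    have := hv.measurable
    fun_prop
  calc _ ≤ ∫⁻ x, (∫⁻ s in Set.Ioc (0 : ℝ) 1,
        I.indicator 1 (x + s • e) * ‖v (x + s • e)‖ₑ ^ p) ∂μ := by
        refine lintegral_mono fun x => ?_
        by_cases hx : x ∈ I
        swap; · simp [hx]
        by_cases hx' : x + e ∈ I
        swap; · simp [hx']
        simp only [hx, hx', Set.indicator_of_mem, Pi.one_apply, one_mul]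
        refine (enorm_sub_rpow_le_lintegral_of_hasLineDerivAt hp hv h x).trans ?_
        refine setLIntegral_mono' measurableSet_Ioc fun s hs => ?_
        have : x + s • e ∈ I := by
          have := hI.add_smul_sub_mem hx hx' ⟨hs.1.le, hs.2⟩
          simpa using this
        simp [this]
    _ = ∫⁻ s in Set.Ioc (0 : ℝ) 1, ∫⁻ x,
        I.indicator 1 (x + s • e) * ‖v (x + s • e)‖ₑ ^ p ∂μ := by
        refine lintegral_lintegral_swap ?_
        exact (hmeas.comp (g := fun x => I.indicator 1 x * ‖v x‖ₑ ^ p)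
          (f := fun q : E × ℝ => q.1 + q.2 • e) (by fun_prop)).aemeasurable
    _ = ∫⁻ s in Set.Ioc (0 : ℝ) 1, ∫⁻ x, I.indicator 1 x * ‖v x‖ₑ ^ p ∂μ := by
        refine lintegral_congr fun s => ?_
        exact lintegral_add_right_eq_self (fun x => I.indicator 1 x * ‖v x‖ₑ ^ p) (s • e)
    _ = ∫⁻ x, I.indicator 1 x * ‖v x‖ₑ ^ p ∂μ := by simp
    _ = _ := by
        rw [← lintegral_indicator hIm]
        refine lintegral_congr fun x => ?_
        by_cases hx : x ∈ I <;> simp [hx]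

lemma lintegral_enorm_sub_rpow_le_univ {p : ℝ} (hp : 1 ≤ p) {u v : E → ℂ} (hv : Continuous v)
    {e : E} (h : ∀ x, HasLineDerivAt ℝ u (v x) x e) :
    ∫⁻ x, ‖u (x + e) - u x‖ₑ ^ p ∂μ ≤ ∫⁻ x, ‖v x‖ₑ ^ p ∂μ := by
  simpa using lintegral_enorm_sub_rpow_le (μ := μ) hp convex_univ MeasurableSet.univ hv h

lemma lintegral_enorm_second_difference_rpow_le {p : ℝ} (hp : 1 ≤ p) {u v w : E → ℂ}
    (hv : Continuous v) (hw : Continuous w) {y : E}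
    (h : ∀ x, HasLineDerivAt ℝ u (v x) x y) (h' : ∀ x, HasLineDerivAt ℝ v (w x) x y) :
    ∫⁻ x, ‖u (x + y) - 2 * u x + u (x - y)‖ₑ ^ p ∂μ ≤ ∫⁻ x, ‖w x‖ₑ ^ p ∂μ := by
  have h1 := lintegral_enorm_sub_rpow_le_univ (μ := μ) hp (v := fun x => v x - v (x - y))
    (by fun_prop) (hasLineDerivAt_sub_translate h y)
  have h2 := lintegral_enorm_sub_rpow_le_univ (μ := μ) hp hw h'
  rw [← lintegral_add_right_eq_self (fun x => ‖v x - v (x - y)‖ₑ ^ p) y] at h1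
  simp only [add_sub_cancel_right] at h1
  refine le_trans (le_of_eq ?_) (h1.trans h2)
  refine lintegral_congr fun x => ?_
  congr 2
  ring

lemma ENNReal.add_three_rpow_le {p : ℝ} (hp : 1 ≤ p) (a b c : ℝ≥0∞) :
    (a + b + c) ^ p ≤ 3 ^ (p - 1) * (a ^ p + b ^ p + c ^ p) := by
  simpa [Fin.sum_univ_three] using
    ENNReal.rpow_sum_le_const_mul_sum_rpow (Finset.univ : Finset (Fin 3)) ![a, b, c] hp

/-- A Landau type inequality: a first derivative is controlled by the function and the second
derivative. -/
lemma lintegral_enorm_rpow_le_of_second_lineDeriv {p : ℝ} (hp : 1 ≤ p) {u v w : E → ℂ}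
    (hu : Continuous u) (hv : Continuous v) (hw : Continuous w) {e : E}
    (h : ∀ x, HasLineDerivAt ℝ u (v x) x e) (h' : ∀ x, HasLineDerivAt ℝ v (w x) x e) :
    ∫⁻ x, ‖v x‖ₑ ^ p ∂μ ≤
      3 ^ (p - 1) * (2 * ∫⁻ x, ‖u x‖ₑ ^ p ∂μ + ∫⁻ x, ‖w x‖ₑ ^ p ∂μ) := by
  have hp0 : 0 ≤ p := by linarith
  have hD : ∀ s ∈ Set.Ioc (0 : ℝ) 1,
      ∫⁻ x, ‖v (x + s • e) - v x‖ₑ ^ p ∂μ ≤ ∫⁻ x, ‖w x‖ₑ ^ p ∂μ := by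
    intro s hs
    have hl : ∀ x, HasLineDerivAt ℝ v (s • w x) x (s • e) := fun x => (h' x).smul s
    refine (lintegral_enorm_sub_rpow_le_univ (μ := μ) hp (by fun_prop) hl).trans ?_
    refine lintegral_mono fun x => ENNReal.rpow_le_rpow ?_ hp0
    rw [enorm_smul]
    refine mul_le_of_le_one_left' ?_
    rw [← ofReal_norm, ENNReal.ofReal_le_one, Real.norm_of_nonneg hs.1.le]
    exact hs.2
  have hpt : ∀ x, ‖v x‖ₑ ^ p ≤ 3 ^ (p - 1) * (‖u (x + e)‖ₑ ^ p + ‖u x‖ₑ ^ p +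
      ∫⁻ s in Set.Ioc (0 : ℝ) 1, ‖v (x + s • e) - v x‖ₑ ^ p) := by
    intro x
    have h1 : ∫ s in (0 : ℝ)..1, v (x + s • e) = u (x + (1 : ℝ) • e) - u (x + (0 : ℝ) • e) :=
      intervalIntegral.integral_eq_sub_of_hasDerivAt
        (fun s _ => hasDerivAt_of_hasLineDerivAt h x s)
        (Continuous.intervalIntegrable (by fun_prop) _ _)
    have h2 : ∫ s in (0 : ℝ)..1, (v (x + s • e) - v x) = u (x + e) - u x - v x := by
      rw [intervalIntegral.integral_sub (Continuous.intervalIntegrable (by fun_prop) _ _)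
        (Continuous.intervalIntegrable (by fun_prop) _ _), h1]
      simp
    rw [intervalIntegral.integral_of_le zero_le_one] at h2
    have h3 : v x = u (x + e) - u x - ∫ s in Set.Ioc (0 : ℝ) 1, (v (x + s • e) - v x) := by
      rw [h2]; ring
    have h4 : ‖v x‖ₑ ≤ ‖u (x + e)‖ₑ + ‖u x‖ₑ +
        ∫⁻ s in Set.Ioc (0 : ℝ) 1, ‖v (x + s • e) - v x‖ₑ := by
      conv_lhs => rw [h3]
      refine (enorm_sub_le).trans (add_le_add enorm_sub_le ?_)
      exact enorm_integral_le_lintegral_enorm _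
    refine (ENNReal.rpow_le_rpow h4 hp0).trans ((ENNReal.add_three_rpow_le hp _ _ _).trans ?_)
    gcongr
    exact lintegral_rpow_le_of_isProbabilityMeasure hp
      (by apply Continuous.aemeasurable; fun_prop)
  have hum := hu.measurable
  have hvm := hv.measurable
  calc _ ≤ ∫⁻ x, 3 ^ (p - 1) * (‖u (x + e)‖ₑ ^ p + ‖u x‖ₑ ^ p +
      ∫⁻ s in Set.Ioc (0 : ℝ) 1, ‖v (x + s • e) - v x‖ₑ ^ p) ∂μ := lintegral_mono hpt
    _ = 3 ^ (p - 1) * (∫⁻ x, ‖u (x + e)‖ₑ ^ p ∂μ + ∫⁻ x, ‖u x‖ₑ ^ p ∂μ +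
      ∫⁻ x, (∫⁻ s in Set.Ioc (0 : ℝ) 1, ‖v (x + s • e) - v x‖ₑ ^ p) ∂μ) := by
        rw [lintegral_const_mul' _ _ (by finiteness), lintegral_add_left (by fun_prop),
          lintegral_add_left (by fun_prop)]
    _ ≤ 3 ^ (p - 1) * (∫⁻ x, ‖u x‖ₑ ^ p ∂μ + ∫⁻ x, ‖u x‖ₑ ^ p ∂μ +
          ∫⁻ x, ‖w x‖ₑ ^ p ∂μ) := by
        rw [lintegral_add_right_eq_self (fun x => ‖u x‖ₑ ^ p) e]
        gcongr _ * (_ + ?_)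
        rw [lintegral_lintegral_swap (by fun_prop)]
        refine (setLIntegral_mono' measurableSet_Ioc hD).trans ?_
        simp
    _ = _ := by rw [two_mul]

end Slices

section Kernel

variable {E : Type*} [NormedAddCommGroup E] [MeasurableSpace E] [BorelSpace E]

lemma lintegral_min_one_rpow_mul_kernel_ne_top [NormedSpace ℝ E] [FiniteDimensional ℝ E]
    [Nontrivial E]
    (μ : Measure E) [μ.IsAddHaarMeasure] {e q : ℝ} (he : 0 < e) (heq : e < q) :
    ∫⁻ y, min 1 (‖y‖ₑ ^ q) * ENNReal.ofReal ((‖y‖ ^ ((Module.finrank ℝ E : ℝ) + e))⁻¹) ∂μ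
      ≠ ∞ := by
  have hq : 0 < q := he.trans heq
  set d := Module.finrank ℝ E with hd
  have hdpos : 0 < d := Module.finrank_pos
  let f : ℝ → ℝ := fun r => min 1 (r ^ q) * (r ^ ((d : ℝ) + e))⁻¹
  have hpow : ∀ r ∈ Set.Ioi (0 : ℝ), r ^ (d - 1) • f r = min 1 (r ^ q) * r ^ (-1 - e) := by
    intro r hr
    have hr' : (0 : ℝ) < r := hr
    have h1 : r ^ (d - 1) = r ^ ((d : ℝ) - 1) := by
      rw [← Real.rpow_natCast, Nat.cast_sub hdpos, Nat.cast_one]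
    simp only [f, smul_eq_mul]
    rw [h1, ← Real.rpow_neg hr'.le, mul_left_comm, ← Real.rpow_add hr']
    congr 2
    ring
  have hf : Integrable (fun y : E => f ‖y‖) μ := by
    rw [integrable_fun_norm_addHaar]
    refine (integrableOn_congr_fun hpow measurableSet_Ioi).2 ?_
    rw [← Set.Ioc_union_Ioi_eq_Ioi zero_le_one]
    refine IntegrableOn.union ?_ ?_
    · have h : IntegrableOn (fun r : ℝ => r ^ (q - 1 - e)) (Set.Ioc 0 1) := by
        rw [← intervalIntegrable_iff_integrableOn_Ioc_of_le zero_le_one]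
        exact intervalIntegral.intervalIntegrable_rpow' (by linarith)
      refine h.congr_fun (fun r hr => ?_) measurableSet_Ioc
      simp only
      rw [min_eq_right (Real.rpow_le_one hr.1.le hr.2 hq.le), ← Real.rpow_add hr.1]
      congr 1
      ring
    · have h : IntegrableOn (fun r : ℝ => r ^ (-1 - e)) (Set.Ioi 1) :=
        integrableOn_Ioi_rpow_of_lt (by linarith) one_pos
      refine h.congr_fun (fun r hr => ?_) measurableSet_Ioi
      simp only
      rw [min_eq_left (Real.one_le_rpow (le_of_lt hr) hq.le), one_mul]
  refine ne_of_eq_of_ne (lintegral_congr fun y => ?_) hf.lintegral_lt_top.ne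
  simp only [f]
  rw [ENNReal.ofReal_mul (by positivity), ENNReal.ofReal_min, ENNReal.ofReal_one,
    ← ENNReal.ofReal_rpow_of_nonneg (norm_nonneg _) hq.le, ofReal_norm]

lemma min_le_min_one_mul (a A B : ℝ≥0∞) : min A (a * B) ≤ min 1 a * (A + B) := by
  rcases le_total 1 a with h | h
  · rw [min_eq_left h, one_mul]
    exact (min_le_left _ _).trans le_self_add
  · rw [min_eq_right h]
    exact (min_le_right _ _).trans (by gcongr; exact le_add_self)

lemma lintegral_mul_kernel_le {μ : Measure E} {q : ℝ} {J κ : E → ℝ≥0∞} {A B : ℝ≥0∞}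
    (hκ : Measurable κ) (hA : ∀ y, J y ≤ A) (hB : ∀ y, J y ≤ ‖y‖ₑ ^ q * B) :
    ∫⁻ y, J y * κ y ∂μ ≤ (∫⁻ y, min 1 (‖y‖ₑ ^ q) * κ y ∂μ) * (A + B) := by
  rw [← lintegral_mul_const _ (by fun_prop)]
  refine lintegral_mono fun y => ?_
  have := (le_min (hA y) (hB y)).trans (min_le_min_one_mul _ A B)
  calc _ ≤ min 1 (‖y‖ₑ ^ q) * (A + B) * κ y := by gcongr
    _ = _ := by ring

end Kernel

lemma ENNReal.add_two_rpow_le {p : ℝ} (hp : 1 ≤ p) (a b : ℝ≥0∞) :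
    (a + b) ^ p ≤ 2 ^ (p - 1) * (a ^ p + b ^ p) := by
  simpa [Fin.sum_univ_two] using
    ENNReal.rpow_sum_le_const_mul_sum_rpow (Finset.univ : Finset (Fin 2)) ![a, b] hp

lemma enorm_sub_rpow_le {p : ℝ} (hp : 1 ≤ p) (a b : ℂ) :
    ‖a - b‖ₑ ^ p ≤ 2 ^ (p - 1) * (‖a‖ₑ ^ p + ‖b‖ₑ ^ p) :=
  (ENNReal.rpow_le_rpow enorm_sub_le (by linarith)).trans (ENNReal.add_two_rpow_le hp _ _)

/-- Fractional regularity in one variable from one derivative. -/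
lemma lintegral_lintegral_enorm_sub_rpow_mul_le {p : ℝ} (hp : 1 ≤ p) {I : Set ℝ}
    (hI : Convex ℝ I) (hIm : MeasurableSet I) {u v : ℝ → ℂ} (hu : Continuous u)
    (hv : Continuous v) (h : ∀ t, HasDerivAt u (v t) t) {κ : ℝ → ℝ≥0∞} (hκ : Measurable κ)
    (hκ' : ∀ t, κ (-t) = κ t) :
    ∫⁻ t in I, ∫⁻ s in I, ‖u t - u s‖ₑ ^ p * κ (t - s) ≤
      (∫⁻ r, min 1 (‖r‖ₑ ^ p) * κ r) *
        (2 ^ (p - 1) * ((∫⁻ t in I, ‖u t‖ₑ ^ p) + ∫⁻ t in I, ‖u t‖ₑ ^ p) +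
          ∫⁻ t in I, ‖v t‖ₑ ^ p) := by
  have hp0 : 0 ≤ p := by linarith
  have hum := hu.measurable
  have hone : Measurable (I.indicator (1 : ℝ → ℝ≥0∞)) := measurable_one.indicator hIm
  have hind : ∀ F : ℝ → ℝ≥0∞, ∫⁻ t in I, F t = ∫⁻ t, I.indicator 1 t * F t := by
    intro F
    rw [← lintegral_indicator hIm]
    refine lintegral_congr fun x => ?_
    by_cases hx : x ∈ I <;> simp [hx]
  let J : ℝ → ℝ≥0∞ := fun r =>
    ∫⁻ t, I.indicator 1 t * I.indicator 1 (t + r) * ‖u (t + r) - u t‖ₑ ^ p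
  have hJ : ∫⁻ t in I, ∫⁻ s in I, ‖u t - u s‖ₑ ^ p * κ (t - s) = ∫⁻ r, J r * κ r := by
    calc _ = ∫⁻ t, ∫⁻ s, I.indicator 1 t * (I.indicator 1 s *
          (‖u t - u s‖ₑ ^ p * κ (t - s))) := by
          simp_rw [hind]
          refine lintegral_congr fun t => ?_
          rw [lintegral_const_mul _ (by fun_prop)]
      _ = ∫⁻ t, ∫⁻ r, I.indicator 1 t * I.indicator 1 (t + r) * ‖u (t + r) - u t‖ₑ ^ p * κ r := by
          refine lintegral_congr fun t => ?_
          rw [← lintegral_add_left_eq_self _ t]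
          refine lintegral_congr fun r => ?_
          rw [sub_add_cancel_left, hκ', ← enorm_neg, neg_sub]
          ring
      _ = ∫⁻ r, ∫⁻ t, I.indicator 1 t * I.indicator 1 (t + r) * ‖u (t + r) - u t‖ₑ ^ p * κ r :=
          lintegral_lintegral_swap (by fun_prop)
      _ = _ := by
          refine lintegral_congr fun r => ?_
          rw [lintegral_mul_const _ (by fun_prop)]
  rw [hJ]
  refine lintegral_mul_kernel_le hκ (fun r => ?_) (fun r => ?_)
  · calc J r ≤ ∫⁻ t, 2 ^ (p - 1) * (I.indicator 1 (t + r) * ‖u (t + r)‖ₑ ^ p +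
          I.indicator 1 t * ‖u t‖ₑ ^ p) := by
          refine lintegral_mono fun t => ?_
          by_cases ht : t ∈ I
          swap; · simp [ht]
          by_cases ht' : t + r ∈ I
          swap; · simp [ht']
          simpa [ht, ht'] using enorm_sub_rpow_le hp (u (t + r)) (u t)
      _ = _ := by
          rw [lintegral_const_mul _ (by fun_prop), lintegral_add_left (by fun_prop),
            lintegral_add_right_eq_self (fun t => I.indicator 1 t * ‖u t‖ₑ ^ p), ← hind]
  · have hl : ∀ t, HasLineDerivAt ℝ u (r • v t) t r := by
      intro t
      have := (h t).hasFDerivAt.hasLineDerivAt r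
      simpa using this
    refine (lintegral_enorm_sub_rpow_le hp hI hIm (by fun_prop) hl).trans ?_
    simp_rw [enorm_smul, ENNReal.mul_rpow_of_nonneg _ _ hp0]
    rw [lintegral_const_mul _ (by have := hv.measurable; fun_prop)]

section Space

variable {n : ℕ} {p : ℝ}

/-- `v` is the gradient of `u`, in coordinates. -/
def IsGradient (u : Rn n → ℂ) (v : Fin n → Rn n → ℂ) : Prop :=
  ∀ x e, HasLineDerivAt ℝ u (∑ k, (e k : ℂ) * v k x) x e

lemma IsGradient.hasLineDerivAt_single {u : Rn n → ℂ} {v : Fin n → Rn n → ℂ}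
    (h : IsGradient u v) (k : Fin n) (x : Rn n) :
    HasLineDerivAt ℝ u (v k x) x (EuclideanSpace.single k 1) := by
  have := h x (EuclideanSpace.single k 1)
  simpa [Pi.single_apply, apply_ite Complex.ofReal] using this

lemma IsGradient.sum {u : Fin n → Rn n → ℂ} {v : Fin n → Fin n → Rn n → ℂ}
    (h : ∀ k, IsGradient (u k) (v k)) (c : Fin n → ℂ) (x e : Rn n) :
    HasLineDerivAt ℝ (fun x => ∑ k, c k * u k x) (∑ k, c k * ∑ j, (e j : ℂ) * v k j x) x e := by
  unfold HasLineDerivAt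
  exact HasDerivAt.fun_sum fun k _ => (h k x e).const_mul (c k)

lemma enorm_coord_le (y : Rn n) (k : Fin n) : ‖(y k : ℂ)‖ₑ ≤ ‖y‖ₑ := by
  rw [← ofReal_norm, ← ofReal_norm]
  refine ENNReal.ofReal_le_ofReal ?_
  simpa using PiLp.norm_apply_le y k

lemma enorm_quadratic_le (y : Rn n) (a : Fin n → Fin n → ℂ) :
    ‖∑ k, (y k : ℂ) * ∑ j, (y j : ℂ) * a k j‖ₑ ≤
      ‖y‖ₑ ^ (2 : ℝ) * ∑ q : Fin n × Fin n, ‖a q.1 q.2‖ₑ := by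
  rw [Fintype.sum_prod_type, Finset.mul_sum]
  refine (enorm_sum_le _ _).trans (Finset.sum_le_sum fun k _ => ?_)
  rw [enorm_mul, ENNReal.rpow_two, sq, mul_assoc]
  refine mul_le_mul' (enorm_coord_le y k) ?_
  rw [Finset.mul_sum]
  refine (enorm_sum_le _ _).trans (Finset.sum_le_sum fun j _ => ?_)
  rw [enorm_mul]
  exact mul_le_mul' (enorm_coord_le y j) le_rfl

/-- Fractional regularity of order less than two from second derivatives. -/
lemma lintegral_lintegral_enorm_second_difference_rpow_mul_le (hp : 1 ≤ p)
    {u : Rn n → ℂ} {v : Fin n → Rn n → ℂ} {w : Fin n → Fin n → Rn n → ℂ}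
    (hu : Continuous u) (hv : ∀ k, Continuous (v k)) (hw : ∀ k j, Continuous (w k j))
    (h : IsGradient u v) (h' : ∀ k, IsGradient (v k) (w k))
    {κ : Rn n → ℝ≥0∞} (hκ : Measurable κ) :
    ∫⁻ x, ∫⁻ y, ‖u (x + y) - 2 * u x + u (x - y)‖ₑ ^ p * κ y ≤
      (∫⁻ y, min 1 (‖y‖ₑ ^ (2 * p)) * κ y) *
        (3 ^ (p - 1) * (2 ^ p + 2) * (∫⁻ x, ‖u x‖ₑ ^ p) +
          ((n * n : ℕ) : ℝ≥0∞) ^ (p - 1) * ∑ q : Fin n × Fin n, ∫⁻ x, ‖w q.1 q.2 x‖ₑ ^ p) := by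
  have hp0 : 0 ≤ p := by linarith
  have hum := hu.measurable
  have hwm := fun k j => (hw k j).measurable
  rw [lintegral_lintegral_swap (by fun_prop)]
  have hmul : ∀ y, ∫⁻ x, ‖u (x + y) - 2 * u x + u (x - y)‖ₑ ^ p * κ y =
      (∫⁻ x, ‖u (x + y) - 2 * u x + u (x - y)‖ₑ ^ p) * κ y :=
    fun y => lintegral_mul_const _ (by fun_prop)
  simp_rw [hmul]
  refine lintegral_mul_kernel_le hκ (fun y => ?_) (fun y => ?_)
  · calc _ ≤ ∫⁻ x, 3 ^ (p - 1) * (‖u (x + y)‖ₑ ^ p + 2 ^ p * ‖u x‖ₑ ^ p + ‖u (x - y)‖ₑ ^ p) := by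
          refine lintegral_mono fun x => ?_
          refine (ENNReal.rpow_le_rpow ((enorm_add_le _ _).trans
            (add_le_add_left enorm_sub_le _)) hp0).trans ?_
          refine (ENNReal.add_three_rpow_le hp _ _ _).trans ?_
          rw [enorm_mul, ENNReal.mul_rpow_of_nonneg _ _ hp0]
          simp [← ofReal_norm]
      _ = _ := by
          rw [lintegral_const_mul _ (by fun_prop), lintegral_add_left (by fun_prop),
            lintegral_add_left (by fun_prop), lintegral_const_mul _ (by fun_prop),
            lintegral_add_right_eq_self (fun x => ‖u x‖ₑ ^ p),
            lintegral_sub_right_eq_self (fun x => ‖u x‖ₑ ^ p)]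
          ring
  · refine (lintegral_enorm_second_difference_rpow_le hp (v := fun x => ∑ k, (y k : ℂ) * v k x)
      (w := fun x => ∑ k, (y k : ℂ) * ∑ j, (y j : ℂ) * w k j x) (by fun_prop) (by fun_prop)
      (fun x => h x y) (fun x => IsGradient.sum h' _ x y)).trans ?_
    calc _ ≤ ∫⁻ x, ‖y‖ₑ ^ (2 * p) * (((n * n : ℕ) : ℝ≥0∞) ^ (p - 1) *
          ∑ q : Fin n × Fin n, ‖w q.1 q.2 x‖ₑ ^ p) := by
          refine lintegral_mono fun x => ?_
          refine (ENNReal.rpow_le_rpow (enorm_quadratic_le y _) hp0).trans ?_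
          rw [ENNReal.mul_rpow_of_nonneg _ _ hp0, ← ENNReal.rpow_mul]
          gcongr
          simpa using ENNReal.rpow_sum_le_const_mul_sum_rpow (Finset.univ : Finset (Fin n × Fin n))
            (fun q => ‖w q.1 q.2 x‖ₑ) hp
      _ = _ := by
          rw [lintegral_const_mul _ (by fun_prop), lintegral_const_mul _ (by fun_prop),
            lintegral_finsetSum _ (fun q _ => by fun_prop)]

/-- The Besov type second difference energy of a first derivative is controlled by those of the
function and of the second derivative. -/
lemma lintegral_lintegral_second_difference_deriv_le (hp : 1 ≤ p) {u v w : Rn n → ℂ} {e : Rn n}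
    (hu : Continuous u) (hv : Continuous v) (hw : Continuous w)
    (h : ∀ x, HasLineDerivAt ℝ u (v x) x e) (h' : ∀ x, HasLineDerivAt ℝ v (w x) x e)
    {κ : Rn n → ℝ≥0∞} (hκ : Measurable κ) :
    ∫⁻ x, ∫⁻ y, ‖v (x + y) - 2 * v x + v (x - y)‖ₑ ^ p * κ y ≤
      3 ^ (p - 1) * (2 * (∫⁻ x, ∫⁻ y, ‖u (x + y) - 2 * u x + u (x - y)‖ₑ ^ p * κ y) +
        ∫⁻ x, ∫⁻ y, ‖w (x + y) - 2 * w x + w (x - y)‖ₑ ^ p * κ y) := by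
  have hum := hu.measurable
  have hvm := hv.measurable
  have hwm := hw.measurable
  have hdiff : ∀ {a b : Rn n → ℂ}, (∀ x, HasLineDerivAt ℝ a (b x) x e) → ∀ y x,
      HasLineDerivAt ℝ (fun x => a (x + y) - 2 * a x + a (x - y))
        (b (x + y) - 2 * b x + b (x - y)) x e := by
    intro a b hab y x
    have h1 := hab (x + y)
    have h2 := hab (x - y)
    unfold HasLineDerivAt at h1 h2 ⊢
    simp only [add_right_comm _ _ y, ← sub_add_eq_add_sub _ y] at h1 h2 ⊢
    exact (h1.sub ((hab x).const_mul 2)).add h2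
  have hsw : ∀ {a : Rn n → ℂ}, Measurable a →
      ∫⁻ x, ∫⁻ y, ‖a (x + y) - 2 * a x + a (x - y)‖ₑ ^ p * κ y =
        ∫⁻ y, (∫⁻ x, ‖a (x + y) - 2 * a x + a (x - y)‖ₑ ^ p) * κ y := by
    intro a ha
    rw [lintegral_lintegral_swap (by fun_prop)]
    refine lintegral_congr fun y => ?_
    rw [lintegral_mul_const _ (by fun_prop)]
  have hM : ∀ {a : Rn n → ℂ}, Measurable a →
      Measurable fun y => ∫⁻ x, ‖a (x + y) - 2 * a x + a (x - y)‖ₑ ^ p := by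
    intro a ha
    exact Measurable.lintegral_prod_right' (f := fun q : Rn n × Rn n =>
      ‖a (q.2 + q.1) - 2 * a q.2 + a (q.2 - q.1)‖ₑ ^ p) (by fun_prop)
  have hMu := hM hum
  have hMw := hM hwm
  rw [hsw hum, hsw hvm, hsw hwm, ← lintegral_const_mul _ (by fun_prop),
    ← lintegral_add_left (by fun_prop), ← lintegral_const_mul _ (by fun_prop)]
  refine lintegral_mono fun y => ?_
  calc _ ≤ _ := mul_le_mul_left (lintegral_enorm_rpow_le_of_second_lineDeriv hp (by fun_prop)
        (by fun_prop) (by fun_prop) (hdiff h y) (hdiff h' y)) _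
    _ = _ := by ring

end Space

section Strip

open scoped LineDeriv SchwartzMap

variable {n : ℕ} {p b : ℝ} {T : ℝ≥0∞}

/-- The spatial partial derivative as an operator on Schwartz functions. -/
def schwartzDX (k : Fin n) (g : 𝓢(Rn1 n, ℂ)) : 𝓢(Rn1 n, ℂ) :=
  ∂_{((EuclideanSpace.single k 1, 0) : Rn1 n)} g

/-- The time derivative as an operator on Schwartz functions. -/
def schwartzDT (g : 𝓢(Rn1 n, ℂ)) : 𝓢(Rn1 n, ℂ) := ∂_{((0, 1) : Rn1 n)} g

lemma coe_schwartzDX (k : Fin n) (g : 𝓢(Rn1 n, ℂ)) : ⇑(schwartzDX k g) = dX k ⇑g := rfl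

lemma coe_schwartzDT (g : 𝓢(Rn1 n, ℂ)) : ⇑(schwartzDT g) = dT ⇑g := rfl

lemma SchwartzMap.lineDerivOp_lineDerivOp_comm {E F : Type*} [NormedAddCommGroup E]
    [NormedSpace ℝ E] [NormedAddCommGroup F] [NormedSpace ℝ F] (a c : E) (g : 𝓢(E, F)) :
    ∂_{a} (∂_{c} g) = ∂_{c} (∂_{a} g) := by
  ext x
  have hd : DifferentiableAt ℝ (fderiv ℝ g) x :=
    ((g.smooth 2).fderiv_right (m := 1) (by norm_num)).differentiable (by norm_num) x
  have key : ∀ v w : E, ∂_{v} (∂_{w} g) x = fderiv ℝ (fderiv ℝ g) x v w := by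
    intro v w
    rw [SchwartzMap.lineDerivOp_apply_eq_fderiv]
    have : ⇑(∂_{w} g : 𝓢(E, F)) = fun y => fderiv ℝ g y w := rfl
    rw [this, fderiv_clm_apply hd (differentiableAt_const w)]
    simp
  rw [key, key]
  exact ((g.smooth 2).contDiffAt.isSymmSndFDerivAt (by simp)).eq a c

lemma schwartzDX_comm (k j : Fin n) : Function.Commute (schwartzDX (n := n) k) (schwartzDX j) :=
  fun g => g.lineDerivOp_lineDerivOp_comm _ _

lemma schwartzDX_schwartzDT_comm (k : Fin n) :
    Function.Commute (schwartzDX (n := n) k) schwartzDT :=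
  fun g => g.lineDerivOp_lineDerivOp_comm _ _

lemma hasDerivAt_time_slice (g : 𝓢(Rn1 n, ℂ)) (X : Rn n) (t : ℝ) :
    HasDerivAt (fun t => g (X, t)) (schwartzDT g (X, t)) t :=
  g.differentiableAt.hasFDerivAt.comp_hasDerivAt t
    ((hasDerivAt_const t X).prodMk (hasDerivAt_id t))

lemma isGradient_space_slice (g : 𝓢(Rn1 n, ℂ)) (t : ℝ) :
    IsGradient (fun X => g (X, t)) (fun k X => schwartzDX k g (X, t)) := by
  intro X e
  have h1 : HasFDerivAt (fun X : Rn n => ((X, t) : Rn1 n)) (ContinuousLinearMap.inl ℝ (Rn n) ℝ) X :=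
    (hasFDerivAt_id X).prodMk (hasFDerivAt_const t X)
  have h2 := (g.differentiableAt.hasFDerivAt.comp X h1).hasLineDerivAt e
  refine HasDerivAt.congr_deriv h2 ?_
  have he : e = ∑ k, e k • EuclideanSpace.single k (1 : ℝ) := by
    ext j; simp [Pi.single_apply]
  conv_lhs => rw [he]
  rw [map_sum]
  refine Finset.sum_congr rfl fun k _ => ?_
  rw [map_smul]
  simp [coe_schwartzDX, dX]

lemma measurableSet_tSet : MeasurableSet (tSet T) :=
  (measurableSet_lt measurable_const measurable_id).inter
    (measurableSet_lt ENNReal.measurable_ofReal measurable_const)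

lemma convex_tSet : Convex ℝ (tSet T) :=
  Set.OrdConnected.convex ⟨fun _ hx _ hy _ hz =>
    ⟨hx.1.trans_le hz.1, (ENNReal.ofReal_le_ofReal hz.2).trans_lt hy.2⟩⟩

lemma stripMeasure_eq : stripMeasure n T = volume.prod (volume.restrict (tSet T)) := by
  have : {x : Rn1 n | x.2 ∈ tSet T} = Set.univ ×ˢ tSet T := by ext; simp
  rw [stripMeasure, this, Measure.volume_eq_prod, ← Measure.prod_restrict, Measure.restrict_univ]

lemma ofReal_norm_rpow_div (hp : 0 ≤ p) (a : ℂ) (c : ℝ) :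
    ENNReal.ofReal (‖a‖ ^ p / c) = ‖a‖ₑ ^ p * ENNReal.ofReal c⁻¹ := by
  rw [div_eq_mul_inv, ENNReal.ofReal_mul (by positivity),
    ← ENNReal.ofReal_rpow_of_nonneg (norm_nonneg _) hp, ofReal_norm]

lemma lintegral_strip_le (hp : 1 ≤ p) {g : Rn1 n → ℂ} {M : ℝ≥0∞}
    (h : eLpNorm g (ENNReal.ofReal p) (stripMeasure n T) ≤ M) :
    ∫⁻ x, ‖g x‖ₑ ^ p ∂(stripMeasure n T) ≤ M ^ p := by
  have hp0 : 0 < p := by linarith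
  rw [eLpNorm_eq_lintegral_rpow_enorm_toReal (by simpa using hp0) (by simp),
    ENNReal.toReal_ofReal hp0.le, one_div, ENNReal.rpow_inv_le_iff hp0] at h
  exact h

lemma lintegral_time_space_le (hp : 1 ≤ p) {g : Rn1 n → ℂ} (hg : Continuous g) {M : ℝ≥0∞}
    (h : eLpNorm g (ENNReal.ofReal p) (stripMeasure n T) ≤ M) :
    ∫⁻ t in tSet T, ∫⁻ X : Rn n, ‖g (X, t)‖ₑ ^ p ≤ M ^ p := by
  have h1 := lintegral_strip_le hp h
  have := hg.measurable
  rwa [stripMeasure_eq, lintegral_prod_symm _ (by fun_prop)] at h1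

lemma lintegral_space_time_le (hp : 1 ≤ p) {g : Rn1 n → ℂ} (hg : Continuous g) {M : ℝ≥0∞}
    (h : eLpNorm g (ENNReal.ofReal p) (stripMeasure n T) ≤ M) :
    ∫⁻ X : Rn n, ∫⁻ t in tSet T, ‖g (X, t)‖ₑ ^ p ≤ M ^ p := by
  have h1 := lintegral_strip_le hp h
  have := hg.measurable
  rwa [stripMeasure_eq, lintegral_prod _ (by fun_prop)] at h1

lemma rpow_one_div_le_mul (hp : 1 ≤ p) {A D M : ℝ≥0∞} (h : A ≤ D * M ^ p) :
    A ^ (1 / p) ≤ D ^ (1 / p) * M := by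
  have hp0 : 0 < p := by linarith
  refine (ENNReal.rpow_le_rpow h (by positivity)).trans (le_of_eq ?_)
  rw [ENNReal.mul_rpow_of_nonneg _ _ (by positivity), ← ENNReal.rpow_mul,
    mul_one_div_cancel hp0.ne', ENNReal.rpow_one]

lemma le_rpow_of_rpow_one_div_le (hp : 1 ≤ p) {A M : ℝ≥0∞} (h : A ^ (1 / p) ≤ M) : A ≤ M ^ p := by
  rwa [one_div, ENNReal.rpow_inv_le_iff (by linarith)] at h

/-- The kernel of the Besov seminorms. -/
def besovKernel {E : Type*} [Norm E] (r : ℝ) (y : E) : ℝ≥0∞ := ENNReal.ofReal (‖y‖ ^ r)⁻¹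

lemma measurable_besovKernel {E : Type*} [NormedAddCommGroup E] [MeasurableSpace E]
    [BorelSpace E] (r : ℝ) : Measurable (besovKernel (E := E) r) := by
  unfold besovKernel
  fun_prop

lemma semT_eq (hp : 1 ≤ p) (g : Rn1 n → ℂ) :
    semT b p T g = (∫⁻ X : Rn n, ∫⁻ t in tSet T, ∫⁻ s in tSet T,
      ‖g (X, t) - g (X, s)‖ₑ ^ p * besovKernel (1 + p * b / 2) (t - s)) ^ (1 / p) := by
  simp_rw [semT, ofReal_norm_rpow_div (show 0 ≤ p by linarith), besovKernel, Real.norm_eq_abs]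

lemma semX_eq (hp : 1 ≤ p) (g : Rn1 n → ℂ) :
    semX b p T g = (∫⁻ t in tSet T, ∫⁻ X : Rn n, ∫⁻ Y : Rn n,
      ‖g (X + Y, t) - 2 * g (X, t) + g (X - Y, t)‖ₑ ^ p * besovKernel (n + p * b) Y) ^ (1 / p) := by
  simp_rw [semX, ofReal_norm_rpow_div (show 0 ≤ p by linarith), besovKernel]

lemma exists_semT_le (n : ℕ) (T : ℝ≥0∞) (hp : 1 ≤ p) (hb : 0 < b) (hb2 : b < 2) :
    ∃ C : ℝ≥0∞, C ≠ ∞ ∧ ∀ (g : 𝓢(Rn1 n, ℂ)) (M : ℝ≥0∞),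
      eLpNorm g (ENNReal.ofReal p) (stripMeasure n T) ≤ M →
      eLpNorm (schwartzDT g) (ENNReal.ofReal p) (stripMeasure n T) ≤ M →
      semT b p T g ≤ C * M := by
  have hp0 : 0 < p := by linarith
  have hK := lintegral_min_one_rpow_mul_kernel_ne_top (volume : Measure ℝ)
    (e := p * b / 2) (q := p) (by positivity) (by nlinarith)
  simp only [Module.finrank_self, Nat.cast_one] at hK
  change ∫⁻ y : ℝ, min 1 (‖y‖ₑ ^ p) * besovKernel (1 + p * b / 2) y ≠ ∞ at hK
  set K := ∫⁻ y : ℝ, min 1 (‖y‖ₑ ^ p) * besovKernel (1 + p * b / 2) y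
  refine ⟨(K * (2 ^ (p - 1) * (1 + 1) + 1)) ^ (1 / p),
    ENNReal.rpow_ne_top_of_nonneg (by positivity) (by finiteness), fun g M h1 h2 => ?_⟩
  rw [semT_eq hp]
  refine rpow_one_div_le_mul hp ?_
  have h1' := lintegral_space_time_le hp g.continuous h1
  have h2' := lintegral_space_time_le hp (schwartzDT g).continuous h2
  have hgm := g.continuous.measurable
  have hdm := (schwartzDT g).continuous.measurable
  have hgs : Measurable fun X : Rn n => ∫⁻ t in tSet T, ‖g (X, t)‖ₑ ^ p :=
    Measurable.lintegral_prod_right' (f := fun q : Rn n × ℝ => ‖g q‖ₑ ^ p) (by fun_prop)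
  have hds : Measurable fun X : Rn n => ∫⁻ t in tSet T, ‖schwartzDT g (X, t)‖ₑ ^ p :=
    Measurable.lintegral_prod_right' (f := fun q : Rn n × ℝ => ‖schwartzDT g q‖ₑ ^ p) (by fun_prop)
  calc _ ≤ ∫⁻ X : Rn n, K * (2 ^ (p - 1) * ((∫⁻ t in tSet T, ‖g (X, t)‖ₑ ^ p) +
        ∫⁻ t in tSet T, ‖g (X, t)‖ₑ ^ p) + ∫⁻ t in tSet T, ‖schwartzDT g (X, t)‖ₑ ^ p) := by
        refine lintegral_mono fun X => ?_
        exact lintegral_lintegral_enorm_sub_rpow_mul_le hp convex_tSet measurableSet_tSet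
          (by fun_prop) (by fun_prop) (hasDerivAt_time_slice g X) (measurable_besovKernel _)
          (fun t => by simp [besovKernel])
    _ ≤ K * (2 ^ (p - 1) * (M ^ p + M ^ p) + M ^ p) := by
        rw [lintegral_const_mul _ (by fun_prop), lintegral_add_left (by fun_prop),
          lintegral_const_mul _ (by fun_prop), lintegral_add_left (by fun_prop)]
        gcongr
    _ = _ := by ring

lemma exists_semX_le (hn : 1 ≤ n) (T : ℝ≥0∞) (hp : 1 ≤ p) (hb : 0 < b) (hb2 : b < 2) :
    ∃ C : ℝ≥0∞, C ≠ ∞ ∧ ∀ (g : 𝓢(Rn1 n, ℂ)) (M : ℝ≥0∞),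
      eLpNorm g (ENNReal.ofReal p) (stripMeasure n T) ≤ M →
      (∀ k j, eLpNorm (schwartzDX k (schwartzDX j g)) (ENNReal.ofReal p) (stripMeasure n T) ≤ M) →
      semX b p T g ≤ C * M := by
  have hp0 : 0 < p := by linarith
  have : NeZero n := ⟨by omega⟩
  have hK := lintegral_min_one_rpow_mul_kernel_ne_top (volume : Measure (Rn n))
    (e := p * b) (q := 2 * p) (by positivity) (by nlinarith)
  simp only [finrank_euclideanSpace, Fintype.card_fin] at hK
  change ∫⁻ y : Rn n, min 1 (‖y‖ₑ ^ (2 * p)) * besovKernel (n + p * b) y ≠ ∞ at hK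
  set K := ∫⁻ y : Rn n, min 1 (‖y‖ₑ ^ (2 * p)) * besovKernel (n + p * b) y
  refine ⟨(K * (3 ^ (p - 1) * (2 ^ p + 2) + ((n * n : ℕ) : ℝ≥0∞) ^ (p - 1) *
    ∑ q : Fin n × Fin n, 1)) ^ (1 / p),
    ENNReal.rpow_ne_top_of_nonneg (by positivity) ?_, fun g M h1 h2 => ?_⟩
  · have : ((n * n : ℕ) : ℝ≥0∞) ^ (p - 1) ≠ ∞ :=
      ENNReal.rpow_ne_top_of_nonneg (by linarith) (by finiteness)
    have : (2 : ℝ≥0∞) ^ p ≠ ∞ := ENNReal.rpow_ne_top_of_nonneg hp0.le (by finiteness)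
    simp only [Finset.sum_const, nsmul_eq_mul]
    finiteness
  rw [semX_eq hp]
  refine rpow_one_div_le_mul hp ?_
  have h1' := lintegral_time_space_le hp g.continuous h1
  have h2' := fun k j =>
    lintegral_time_space_le hp (schwartzDX k (schwartzDX j g)).continuous (h2 k j)
  have hgm := g.continuous.measurable
  have hdm := fun k j => (schwartzDX k (schwartzDX j g)).continuous.measurable
  have hgs : Measurable fun t : ℝ => ∫⁻ X : Rn n, ‖g (X, t)‖ₑ ^ p :=
    Measurable.lintegral_prod_left' (f := fun q : Rn n × ℝ => ‖g q‖ₑ ^ p) (by fun_prop)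
  have hds : ∀ k j, Measurable fun t : ℝ =>
      ∫⁻ X : Rn n, ‖schwartzDX k (schwartzDX j g) (X, t)‖ₑ ^ p := fun k j =>
    Measurable.lintegral_prod_left'
      (f := fun q : Rn n × ℝ => ‖schwartzDX k (schwartzDX j g) q‖ₑ ^ p) (by fun_prop)
  calc _ ≤ ∫⁻ t in tSet T, K * (3 ^ (p - 1) * (2 ^ p + 2) * (∫⁻ X : Rn n, ‖g (X, t)‖ₑ ^ p) +
          ((n * n : ℕ) : ℝ≥0∞) ^ (p - 1) * ∑ q : Fin n × Fin n,
            ∫⁻ X : Rn n, ‖schwartzDX q.2 (schwartzDX q.1 g) (X, t)‖ₑ ^ p) := by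
        refine lintegral_mono fun t => ?_
        exact lintegral_lintegral_enorm_second_difference_rpow_mul_le hp
          (u := fun X => g (X, t)) (v := fun k X => schwartzDX k g (X, t))
          (w := fun k j X => schwartzDX j (schwartzDX k g) (X, t))
          (by fun_prop) (by fun_prop) (by fun_prop)
          (isGradient_space_slice g t) (fun k => isGradient_space_slice (schwartzDX k g) t)
          (measurable_besovKernel _)
    _ ≤ K * (3 ^ (p - 1) * (2 ^ p + 2) * M ^ p + ((n * n : ℕ) : ℝ≥0∞) ^ (p - 1) *
          ∑ q : Fin n × Fin n, M ^ p) := by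
        rw [lintegral_const_mul _ (by fun_prop), lintegral_add_left (by fun_prop),
          lintegral_const_mul _ (by fun_prop), lintegral_const_mul _ (by fun_prop),
          lintegral_finsetSum _ (fun q _ => by fun_prop)]
        gcongr
        exact h2' _ _
    _ = _ := by
        simp only [Finset.sum_const, nsmul_eq_mul]
        ring

lemma exists_semT_deriv_le (n : ℕ) (T : ℝ≥0∞) (b : ℝ) (hp : 1 ≤ p) :
    ∃ C : ℝ≥0∞, C ≠ ∞ ∧ ∀ (g : 𝓢(Rn1 n, ℂ)) (k : Fin n) (M : ℝ≥0∞), semT b p T g ≤ M →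
      semT b p T (schwartzDX k (schwartzDX k g)) ≤ M → semT b p T (schwartzDX k g) ≤ C * M := by
  have hp0 : 0 < p := by linarith
  refine ⟨(3 ^ (p - 1) * (2 + 1)) ^ (1 / p),
    ENNReal.rpow_ne_top_of_nonneg (by positivity) (by finiteness), fun g k M h1 h2 => ?_⟩
  rw [semT_eq hp] at h1 h2 ⊢
  replace h1 := le_rpow_of_rpow_one_div_le hp h1
  replace h2 := le_rpow_of_rpow_one_div_le hp h2
  refine rpow_one_div_le_mul hp ?_
  have hκ := measurable_besovKernel (E := ℝ) (1 + p * b / 2)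
  set κ : ℝ → ℝ≥0∞ := besovKernel (1 + p * b / 2)
  have hM : ∀ a : 𝓢(Rn1 n, ℂ), Measurable fun q : ℝ × ℝ =>
      ∫⁻ X : Rn n, ‖a (X, q.1) - a (X, q.2)‖ₑ ^ p := by
    intro a
    have := a.continuous.measurable
    exact Measurable.lintegral_prod_left' (f := fun q : Rn n × (ℝ × ℝ) =>
      ‖a (q.1, q.2.1) - a (q.1, q.2.2)‖ₑ ^ p) (by fun_prop)
  have hsw : ∀ a : 𝓢(Rn1 n, ℂ), ∫⁻ X : Rn n, ∫⁻ t in tSet T, ∫⁻ s in tSet T,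
      ‖a (X, t) - a (X, s)‖ₑ ^ p * κ (t - s) =
      ∫⁻ q, (∫⁻ X : Rn n, ‖a (X, q.1) - a (X, q.2)‖ₑ ^ p) * κ (q.1 - q.2)
        ∂((volume.restrict (tSet T)).prod (volume.restrict (tSet T))) := by
    intro a
    have ham := a.continuous.measurable
    calc _ = ∫⁻ X : Rn n, (∫⁻ q, ‖a (X, q.1) - a (X, q.2)‖ₑ ^ p * κ (q.1 - q.2)
        ∂((volume.restrict (tSet T)).prod (volume.restrict (tSet T)))) := by
          refine lintegral_congr fun X => ?_
          rw [lintegral_prod _ (by fun_prop)]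
      _ = _ := by
          rw [lintegral_lintegral_swap (by fun_prop)]
          refine lintegral_congr fun q => ?_
          rw [lintegral_mul_const _ (by fun_prop)]
  rw [hsw] at h1 h2 ⊢
  have hMg := hM g
  have hMd := hM (schwartzDX k (schwartzDX k g))
  calc _ ≤ ∫⁻ q, 3 ^ (p - 1) *
        (2 * ((∫⁻ X : Rn n, ‖g (X, q.1) - g (X, q.2)‖ₑ ^ p) * κ (q.1 - q.2)) +
          (∫⁻ X : Rn n, ‖schwartzDX k (schwartzDX k g) (X, q.1) -
            schwartzDX k (schwartzDX k g) (X, q.2)‖ₑ ^ p) * κ (q.1 - q.2))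
        ∂((volume.restrict (tSet T)).prod (volume.restrict (tSet T))) := by
        refine lintegral_mono fun q => ?_
        have hd : ∀ (a : 𝓢(Rn1 n, ℂ)) (X : Rn n), HasLineDerivAt ℝ
            (fun X => a (X, q.1) - a (X, q.2))
            (schwartzDX k a (X, q.1) - schwartzDX k a (X, q.2)) X (EuclideanSpace.single k 1) :=
          fun a X => HasDerivAt.sub ((isGradient_space_slice a q.1).hasLineDerivAt_single k X)
            ((isGradient_space_slice a q.2).hasLineDerivAt_single k X)
        calc _ ≤ _ := mul_le_mul_left (lintegral_enorm_rpow_le_of_second_lineDeriv hp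
              (by fun_prop) (by fun_prop) (by fun_prop) (hd g) (hd (schwartzDX k g))) _
          _ = _ := by ring
    _ ≤ 3 ^ (p - 1) * (2 * M ^ p + M ^ p) := by
        rw [lintegral_const_mul _ (by fun_prop), lintegral_add_left (by fun_prop),
          lintegral_const_mul _ (by fun_prop)]
        gcongr
    _ = _ := by ring

lemma exists_semX_deriv_le (n : ℕ) (T : ℝ≥0∞) (b : ℝ) (hp : 1 ≤ p) :
    ∃ C : ℝ≥0∞, C ≠ ∞ ∧ ∀ (g : 𝓢(Rn1 n, ℂ)) (k : Fin n) (M : ℝ≥0∞), semX b p T g ≤ M →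
      semX b p T (schwartzDX k (schwartzDX k g)) ≤ M → semX b p T (schwartzDX k g) ≤ C * M := by
  have hp0 : 0 < p := by linarith
  refine ⟨(3 ^ (p - 1) * (2 + 1)) ^ (1 / p),
    ENNReal.rpow_ne_top_of_nonneg (by positivity) (by finiteness), fun g k M h1 h2 => ?_⟩
  rw [semX_eq hp] at h1 h2 ⊢
  replace h1 := le_rpow_of_rpow_one_div_le hp h1
  replace h2 := le_rpow_of_rpow_one_div_le hp h2
  refine rpow_one_div_le_mul hp ?_
  have hκ := measurable_besovKernel (E := Rn n) (n + p * b)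
  set κ : Rn n → ℝ≥0∞ := besovKernel (n + p * b)
  have hM : ∀ a : 𝓢(Rn1 n, ℂ), Measurable fun t : ℝ => ∫⁻ X : Rn n, ∫⁻ Y : Rn n,
      ‖a (X + Y, t) - 2 * a (X, t) + a (X - Y, t)‖ₑ ^ p * κ Y := by
    intro a
    have := a.continuous.measurable
    have h : Measurable fun q : ℝ × Rn n => ∫⁻ Y : Rn n,
        ‖a (q.2 + Y, q.1) - 2 * a (q.2, q.1) + a (q.2 - Y, q.1)‖ₑ ^ p * κ Y :=
      Measurable.lintegral_prod_right' (f := fun q : (ℝ × Rn n) × Rn n =>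
        ‖a (q.1.2 + q.2, q.1.1) - 2 * a (q.1.2, q.1.1) + a (q.1.2 - q.2, q.1.1)‖ₑ ^ p * κ q.2)
        (by fun_prop)
    exact h.lintegral_prod_right'
  have hMg := hM g
  have hMd := hM (schwartzDX k (schwartzDX k g))
  calc _ ≤ ∫⁻ t in tSet T, 3 ^ (p - 1) * (2 * (∫⁻ X : Rn n, ∫⁻ Y : Rn n,
          ‖g (X + Y, t) - 2 * g (X, t) + g (X - Y, t)‖ₑ ^ p * κ Y) +
        ∫⁻ X : Rn n, ∫⁻ Y : Rn n, ‖schwartzDX k (schwartzDX k g) (X + Y, t) -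
          2 * schwartzDX k (schwartzDX k g) (X, t) +
          schwartzDX k (schwartzDX k g) (X - Y, t)‖ₑ ^ p * κ Y) := by
        refine lintegral_mono fun t => ?_
        exact lintegral_lintegral_second_difference_deriv_le hp (u := fun X => g (X, t))
          (v := fun X => schwartzDX k g (X, t))
          (w := fun X => schwartzDX k (schwartzDX k g) (X, t))
          (by fun_prop) (by fun_prop) (by fun_prop)
          ((isGradient_space_slice g t).hasLineDerivAt_single k)
          ((isGradient_space_slice (schwartzDX k g) t).hasLineDerivAt_single k) hκ
    _ ≤ 3 ^ (p - 1) * (2 * M ^ p + M ^ p) := by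
        rw [lintegral_const_mul _ (by fun_prop), lintegral_add_left (by fun_prop),
          lintegral_const_mul _ (by fun_prop)]
        gcongr
    _ = _ := by ring

end Strip

section MixedDeriv

open scoped SchwartzMap

variable {n : ℕ} {p b α : ℝ} {T : ℝ≥0∞}

/-- The mixed derivative `D_X^β D_t^l g` of a Schwartz function. -/
def mixedDeriv (β : Fin n → ℕ) (l : ℕ) (g : 𝓢(Rn1 n, ℂ)) : 𝓢(Rn1 n, ℂ) :=
  (List.finRange n).foldr (fun k h => (schwartzDX k)^[β k] h) (schwartzDT^[l] g)

lemma coe_iterate_schwartzDX (k : Fin n) (m : ℕ) (g : 𝓢(Rn1 n, ℂ)) :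
    ⇑((schwartzDX k)^[m] g) = (dX k)^[m] ⇑g := by
  induction m with
  | zero => rfl
  | succ m ih => rw [Function.iterate_succ_apply', Function.iterate_succ_apply', coe_schwartzDX, ih]

lemma coe_iterate_schwartzDT (m : ℕ) (g : 𝓢(Rn1 n, ℂ)) : ⇑(schwartzDT^[m] g) = dT^[m] ⇑g := by
  induction m with
  | zero => rfl
  | succ m ih => rw [Function.iterate_succ_apply', Function.iterate_succ_apply', coe_schwartzDT, ih]

lemma coe_mixedDeriv (β : Fin n → ℕ) (l : ℕ) (g : 𝓢(Rn1 n, ℂ)) :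
    ⇑(mixedDeriv β l g) = dXmulti β (dT^[l] ⇑g) := by
  unfold mixedDeriv dXmulti
  induction List.finRange n with
  | nil => exact coe_iterate_schwartzDT l g
  | cons k L ih => rw [List.foldr_cons, List.foldr_cons, coe_iterate_schwartzDX, ih]

lemma mixedDeriv_comm {F : 𝓢(Rn1 n, ℂ) → 𝓢(Rn1 n, ℂ)}
    (hX : ∀ k, Function.Commute (schwartzDX k) F) (hT : Function.Commute schwartzDT F)
    (β : Fin n → ℕ) (l : ℕ) (g : 𝓢(Rn1 n, ℂ)) :
    mixedDeriv β l (F g) = F (mixedDeriv β l g) := by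
  unfold mixedDeriv
  induction List.finRange n with
  | nil => exact (hT.iterate_left l) g
  | cons k L ih =>
    rw [List.foldr_cons, List.foldr_cons, ih]
    exact ((hX k).iterate_left (β k)) _

lemma mixedDeriv_schwartzDX (β : Fin n → ℕ) (l : ℕ) (k : Fin n) (g : 𝓢(Rn1 n, ℂ)) :
    mixedDeriv β l (schwartzDX k g) = schwartzDX k (mixedDeriv β l g) :=
  mixedDeriv_comm (fun j => schwartzDX_comm j k) (schwartzDX_schwartzDT_comm k).symm β l g

lemma mixedDeriv_schwartzDT (β : Fin n → ℕ) (l : ℕ) (g : 𝓢(Rn1 n, ℂ)) :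
    mixedDeriv β l (schwartzDT g) = schwartzDT (mixedDeriv β l g) :=
  mixedDeriv_comm schwartzDX_schwartzDT_comm (Function.Commute.refl _) β l g

lemma mixedDeriv_add_single (β : Fin n → ℕ) (l : ℕ) (k : Fin n) (g : 𝓢(Rn1 n, ℂ)) :
    mixedDeriv (β + Pi.single k 1) l g = mixedDeriv β l (schwartzDX k g) := by
  rw [mixedDeriv_schwartzDX]
  unfold mixedDeriv
  have key : ∀ L : List (Fin n), L.Nodup → ∀ h : 𝓢(Rn1 n, ℂ),
      L.foldr (fun j h => (schwartzDX j)^[(β + Pi.single k 1 : Fin n → ℕ) j] h) h =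
        if k ∈ L then schwartzDX k (L.foldr (fun j h => (schwartzDX j)^[β j] h) h)
        else L.foldr (fun j h => (schwartzDX j)^[β j] h) h := by
    intro L
    induction L with
    | nil => simp
    | cons j L ih =>
      intro hL h
      rw [List.nodup_cons] at hL
      rw [List.foldr_cons, List.foldr_cons, ih hL.2]
      by_cases hjk : j = k
      · subst hjk
        simp [hL.1, Function.iterate_succ_apply']
      · simp only [Pi.add_apply, Pi.single_eq_of_ne hjk, add_zero, List.mem_cons,
          Ne.symm hjk, false_or]
        split_ifs
        · exact ((schwartzDX_comm j k).iterate_left (β j)) _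
        · rfl
  rw [key _ (List.nodup_finRange n), if_pos (List.mem_finRange k)]

lemma sum_add_single (β : Fin n → ℕ) (k : Fin n) :
    ∑ j, (β + Pi.single k 1 : Fin n → ℕ) j = (∑ j, β j) + 1 := by
  simp [Finset.sum_add_distrib]

lemma exists_eq_add_single {β : Fin n → ℕ} (h : ∑ k, β k ≠ 0) :
    ∃ (k : Fin n) (γ : Fin n → ℕ), β = γ + Pi.single k 1 := by
  obtain ⟨k, -, hk⟩ := Finset.exists_ne_zero_of_sum_ne_zero h
  refine ⟨k, β - Pi.single k 1, (tsub_add_cancel_of_le ?_).symm⟩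
  intro j
  by_cases hj : j = k
  · subst hj
    simpa using Nat.one_le_iff_ne_zero.mpr hk
  · simp [Pi.single_eq_of_ne hj]

/-- All the terms of the parabolic Besov norm of `g`, with index `i` and fractional order `b`, are
bounded by `M`. -/
structure BesovTermsLE (i : ℕ) (b p : ℝ) (T : ℝ≥0∞) (g : 𝓢(Rn1 n, ℂ)) (M : ℝ≥0∞) : Prop where
  eLpNorm_le : ∀ (β : Fin n → ℕ) (l : ℕ), (∑ k, β k) + 2 * l ≤ 2 * i →
    eLpNorm (mixedDeriv β l g) (ENNReal.ofReal p) (stripMeasure n T) ≤ M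
  semT_le : ∀ (β : Fin n → ℕ) (l : ℕ), (∑ k, β k) + 2 * l = 2 * i →
    semT b p T (mixedDeriv β l g) ≤ M
  semX_le : ∀ (β : Fin n → ℕ) (l : ℕ), (∑ k, β k) + 2 * l = 2 * i →
    semX b p T (mixedDeriv β l g) ≤ M

lemma BesovTermsLE.mono {i : ℕ} {g : 𝓢(Rn1 n, ℂ)} {M M' : ℝ≥0∞} (h : BesovTermsLE i b p T g M)
    (hM : M ≤ M') : BesovTermsLE i b p T g M' :=
  ⟨fun β l hl => (h.1 β l hl).trans hM, fun β l hl => (h.2 β l hl).trans hM,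
    fun β l hl => (h.3 β l hl).trans hM⟩

lemma exists_pbNorm_le (n i : ℕ) : ∃ K : ℝ≥0∞, K ≠ ∞ ∧ ∀ (α p : ℝ) (T : ℝ≥0∞)
    (g : 𝓢(Rn1 n, ℂ)) (M : ℝ≥0∞), BesovTermsLE i (α - 2 * i) p T g M →
      pbNorm i α p T g ≤ K * M := by
  refine ⟨∑ l ∈ Finset.range (i + 1),
      ∑ β ∈ (Fintype.piFinset fun _ : Fin n => Finset.range (2 * i + 1)).filter
        (fun β => (∑ k, β k) + 2 * l ≤ 2 * i), 1 +
    ∑ l ∈ Finset.range (i + 1),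
      ∑ β ∈ (Fintype.piFinset fun _ : Fin n => Finset.range (2 * i + 1)).filter
        (fun β => (∑ k, β k) + 2 * l = 2 * i), (1 + 1), ?_, fun α p T g M h => ?_⟩
  · exact ENNReal.add_ne_top.mpr
      ⟨ENNReal.sum_ne_top.mpr fun l _ => ENNReal.sum_ne_top.mpr fun β _ => by finiteness,
        ENNReal.sum_ne_top.mpr fun l _ => ENNReal.sum_ne_top.mpr fun β _ => by finiteness⟩
  · simp only [pbNorm, wNorm, add_mul, Finset.sum_mul, one_mul, ← coe_mixedDeriv]
    refine add_le_add (Finset.sum_le_sum fun l _ => Finset.sum_le_sum fun β hβ => ?_)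
      (Finset.sum_le_sum fun l _ => Finset.sum_le_sum fun β hβ => ?_)
    · exact h.1 β l (Finset.mem_filter.mp hβ).2
    · exact add_le_add (h.2 β l (Finset.mem_filter.mp hβ).2) (h.3 β l (Finset.mem_filter.mp hβ).2)

lemma besovTermsLE_pbNorm (i : ℕ) (α p : ℝ) (T : ℝ≥0∞) (g : 𝓢(Rn1 n, ℂ)) :
    BesovTermsLE i (α - 2 * i) p T g (pbNorm i α p T g) := by
  have hmem : ∀ (β : Fin n → ℕ) (l : ℕ), (∑ k, β k) + 2 * l ≤ 2 * i →
      l ∈ Finset.range (i + 1) ∧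
      β ∈ Fintype.piFinset fun _ : Fin n => Finset.range (2 * i + 1) := by
    intro β l h
    refine ⟨Finset.mem_range.mpr (by omega), Fintype.mem_piFinset.mpr fun k => ?_⟩
    have := Finset.single_le_sum (f := β) (fun _ _ => Nat.zero_le _) (Finset.mem_univ k)
    exact Finset.mem_range.mpr (by omega)
  have hsem : ∀ (β : Fin n → ℕ) (l : ℕ), (∑ k, β k) + 2 * l = 2 * i →
      semT (α - 2 * i) p T (mixedDeriv β l g) + semX (α - 2 * i) p T (mixedDeriv β l g) ≤
        pbNorm i α p T g := by
    intro β l h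
    rw [coe_mixedDeriv]
    refine le_trans ?_ le_add_self
    refine le_trans ?_ (Finset.single_le_sum (fun _ _ => zero_le) (hmem β l h.le).1)
    exact Finset.single_le_sum
      (f := fun β => semT (α - 2 * i) p T (dXmulti β (dT^[l] g)) +
        semX (α - 2 * i) p T (dXmulti β (dT^[l] g))) (fun _ _ => zero_le)
      (Finset.mem_filter.mpr ⟨(hmem β l h.le).2, h⟩)
  refine ⟨fun β l h => ?_, fun β l h => le_self_add.trans (hsem β l h),
    fun β l h => le_add_self.trans (hsem β l h)⟩
  rw [coe_mixedDeriv]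
  refine le_trans ?_ le_self_add
  refine le_trans ?_ (Finset.single_le_sum (fun _ _ => zero_le) (hmem β l h).1)
  exact Finset.single_le_sum
    (f := fun β => eLpNorm (dXmulti β (dT^[l] g)) (ENNReal.ofReal p) (stripMeasure n T))
    (fun _ _ => zero_le) (Finset.mem_filter.mpr ⟨(hmem β l h).2, h⟩)

lemma BesovTermsLE.of_derivatives {m : ℕ} {g : 𝓢(Rn1 n, ℂ)} {M : ℝ≥0∞}
    (h0 : BesovTermsLE m b p T g M) (h1 : ∀ k, BesovTermsLE m b p T (schwartzDX k g) M)
    (h2 : ∀ k j, BesovTermsLE m b p T (schwartzDX k (schwartzDX j g)) M)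
    (hT : BesovTermsLE m b p T (schwartzDT g) M) : BesovTermsLE (m + 1) b p T g M := by
  have top : ∀ (P : 𝓢(Rn1 n, ℂ) → Prop),
      (∀ γ l, (∑ k, γ k) + 2 * l = 2 * m → P (mixedDeriv γ l (schwartzDT g))) →
      (∀ γ l, (∑ k, γ k) + 2 * l = 2 * m → ∀ k j,
        P (mixedDeriv γ l (schwartzDX k (schwartzDX j g)))) →
      ∀ (β : Fin n → ℕ) l, (∑ k, β k) + 2 * l = 2 * (m + 1) → P (mixedDeriv β l g) := by
    intro P hPT hPX β l h
    rcases l with _ | l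
    · obtain ⟨j, γ, rfl⟩ := exists_eq_add_single (β := β) (by omega)
      rw [sum_add_single] at h
      obtain ⟨k, γ, rfl⟩ := exists_eq_add_single (β := γ) (by omega)
      rw [sum_add_single] at h
      rw [mixedDeriv_add_single, mixedDeriv_add_single]
      exact hPX γ 0 (by omega) k j
    · exact hPT β l (by omega)
  refine ⟨fun β l h => ?_, ?_, ?_⟩
  · obtain hl | hl | hl : (∑ k, β k) + 2 * l ≤ 2 * m ∨ (∑ k, β k) + 2 * l = 2 * m + 1 ∨
        (∑ k, β k) + 2 * l = 2 * (m + 1) := by omega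
    · exact h0.1 β l hl
    · obtain ⟨k, γ, rfl⟩ := exists_eq_add_single (β := β) (by omega)
      rw [sum_add_single] at hl
      rw [mixedDeriv_add_single]
      exact (h1 k).1 γ l (by omega)
    · exact top (fun u => eLpNorm u (ENNReal.ofReal p) (stripMeasure n T) ≤ M)
        (fun γ l h => hT.1 γ l h.le) (fun γ l h k j => (h2 k j).1 γ l h.le) β l hl
  · exact top (fun u => semT b p T u ≤ M) hT.2 fun γ l h k j => (h2 k j).2 γ l h
  · exact top (fun u => semX b p T u ≤ M) hT.3 fun γ l h k j => (h2 k j).3 γ l h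

lemma BesovTermsLE.schwartzDT {m : ℕ} {g : 𝓢(Rn1 n, ℂ)} {M : ℝ≥0∞}
    (h : BesovTermsLE (m + 1) b p T g M) : BesovTermsLE m b p T (schwartzDT g) M :=
  ⟨fun β l hl => h.1 β (l + 1) (by omega), fun β l hl => h.2 β (l + 1) (by omega),
    fun β l hl => h.3 β (l + 1) (by omega)⟩

lemma BesovTermsLE.schwartzDX_schwartzDX {m : ℕ} {g : 𝓢(Rn1 n, ℂ)} {M : ℝ≥0∞}
    (h : BesovTermsLE (m + 1) b p T g M) (k j : Fin n) :
    BesovTermsLE m b p T (schwartzDX k (schwartzDX j g)) M := by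
  have e : ∀ (β : Fin n → ℕ) l, mixedDeriv β l (schwartzDX k (schwartzDX j g)) =
      mixedDeriv (β + Pi.single k 1 + Pi.single j 1) l g := by
    intro β l
    rw [mixedDeriv_add_single, mixedDeriv_add_single]
  have s := fun β : Fin n → ℕ => (sum_add_single (β + Pi.single k 1) j).trans
    (congrArg (· + 1) (sum_add_single β k))
  refine ⟨fun β l hl => ?_, fun β l hl => ?_, fun β l hl => ?_⟩ <;> rw [e]
  · exact h.1 _ _ (by rw [s]; omega)
  · exact h.2 _ _ (by rw [s]; omega)
  · exact h.3 _ _ (by rw [s]; omega)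

lemma exists_besovTermsLE_succ (hn : 1 ≤ n) (T : ℝ≥0∞) (hp : 1 ≤ p) (hb : 0 < b) (hb2 : b < 2) :
    ∃ C : ℝ≥0∞, C ≠ ∞ ∧ ∀ (m : ℕ) (g : 𝓢(Rn1 n, ℂ)) (M : ℝ≥0∞),
      BesovTermsLE (m + 1) b p T g M → BesovTermsLE m b p T g (C * M) ∧
        (∀ k, BesovTermsLE m b p T (schwartzDX k g) (C * M)) ∧
        (∀ k j, BesovTermsLE m b p T (schwartzDX k (schwartzDX j g)) (C * M)) ∧
        BesovTermsLE m b p T (schwartzDT g) (C * M) := by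
  obtain ⟨C₁, hC₁, h₁⟩ := exists_semT_le n T hp hb hb2
  obtain ⟨C₂, hC₂, h₂⟩ := exists_semX_le hn T hp hb hb2
  obtain ⟨C₃, hC₃, h₃⟩ := exists_semT_deriv_le n T b hp
  obtain ⟨C₄, hC₄, h₄⟩ := exists_semX_deriv_le n T b hp
  set D := 1 + C₁ + C₂ with hD
  set E := 1 + C₃ + C₄ with hE
  refine ⟨E * D, by finiteness, fun m g M h => ?_⟩
  have hD1 : 1 ≤ D := by rw [hD, add_assoc]; exact le_self_add
  have hE1 : 1 ≤ E := by rw [hE, add_assoc]; exact le_self_add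
  have hDM : M ≤ D * M := le_mul_of_one_le_left zero_le hD1
  have hEM : D * M ≤ E * D * M := by
    rw [mul_assoc]
    exact le_mul_of_one_le_left zero_le hE1
  have hgT := h.schwartzDT
  have hgX := fun k j => h.schwartzDX_schwartzDX k j
  have hg : BesovTermsLE m b p T g (D * M) := by
    refine ⟨fun β l hl => (h.1 β l (by omega)).trans hDM, fun β l hl => ?_, fun β l hl => ?_⟩
    · refine (h₁ _ M (h.1 β l (by omega)) ?_).trans ?_
      · rw [← mixedDeriv_schwartzDT]
        exact hgT.1 β l hl.le
      · gcongr
        exact le_add_self.trans le_self_add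
    · refine (h₂ _ M (h.1 β l (by omega)) fun k j => ?_).trans ?_
      · rw [← mixedDeriv_schwartzDX, ← mixedDeriv_schwartzDX]
        exact (hgX k j).1 β l hl.le
      · gcongr
        exact le_add_self
  refine ⟨hg.mono hEM, fun k => ⟨fun β l hl => ?_, fun β l hl => ?_, fun β l hl => ?_⟩,
    fun k j => (hgX k j).mono (hDM.trans hEM), hgT.mono (hDM.trans hEM)⟩
  · rw [← mixedDeriv_add_single]
    exact (h.1 _ l (by rw [sum_add_single]; omega)).trans (hDM.trans hEM)
  · rw [mixedDeriv_schwartzDX]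
    refine (h₃ _ k (D * M) (hg.2 β l hl) ?_).trans ?_
    · rw [← mixedDeriv_schwartzDX, ← mixedDeriv_schwartzDX]
      exact ((hgX k k).2 β l hl).trans hDM
    · rw [mul_assoc]
      gcongr
      exact le_add_self.trans le_self_add
  · rw [mixedDeriv_schwartzDX]
    refine (h₄ _ k (D * M) (hg.3 β l hl) ?_).trans ?_
    · rw [← mixedDeriv_schwartzDX, ← mixedDeriv_schwartzDX]
      exact ((hgX k k).3 β l hl).trans hDM
    · rw [mul_assoc]
      gcongr
      exact le_add_self

end MixedDeriv

/-- For `2i < α < 2i+2` (`i ≥ 1`) and `0 < T ≤ ∞`,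
`‖f‖_{B^{α,α/2}_p(ℝⁿ_T)} ≈ ‖f‖_{B^{α−2}} + Σ_k‖∂_{X_k}f‖_{B^{α−2}} +
Σ_{k,j}‖∂_{X_k}∂_{X_j}f‖_{B^{α−2}} + ‖∂_t f‖_{B^{α−2}}` on `ℝⁿ_T`. -/
theorem stmt12 (n : ℕ) (hn : 1 ≤ n) (p : ℝ) (hp : 1 ≤ p) (T : ℝ≥0∞) (hT : 0 < T)
    (i : ℕ) (hi : 1 ≤ i) (α : ℝ) (hα1 : 2 * (i : ℝ) < α) (hα2 : α < 2 * (i : ℝ) + 2) :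
    ∃ c C : ℝ, 0 < c ∧ 0 < C ∧
      ∀ f : SchwartzMap (Rn1 n) ℂ,
        ENNReal.ofReal c * pbNorm i α p T ⇑f ≤
            pbNorm (i - 1) (α - 2) p T ⇑f
            + ∑ k : Fin n, pbNorm (i - 1) (α - 2) p T (dX k ⇑f)
            + ∑ k : Fin n, ∑ j : Fin n, pbNorm (i - 1) (α - 2) p T (dX k (dX j ⇑f))
            + pbNorm (i - 1) (α - 2) p T (dT ⇑f)
          ∧
          pbNorm (i - 1) (α - 2) p T ⇑f
            + ∑ k : Fin n, pbNorm (i - 1) (α - 2) p T (dX k ⇑f)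
            + ∑ k : Fin n, ∑ j : Fin n, pbNorm (i - 1) (α - 2) p T (dX k (dX j ⇑f))
            + pbNorm (i - 1) (α - 2) p T (dT ⇑f)
            ≤ ENNReal.ofReal C * pbNorm i α p T ⇑f := by
  obtain ⟨m, rfl⟩ : ∃ m, i = m + 1 := ⟨i - 1, by omega⟩
  rw [Nat.add_sub_cancel]
  have hb : α - 2 - 2 * (m : ℝ) = α - 2 * ((m + 1 : ℕ) : ℝ) := by push_cast; ring
  obtain ⟨K, hK, hle⟩ := exists_pbNorm_le n (m + 1)
  obtain ⟨L, hL, hle'⟩ := exists_pbNorm_le n m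
  obtain ⟨D, hD, hsucc⟩ := exists_besovTermsLE_succ (b := α - 2 * ((m + 1 : ℕ) : ℝ)) hn T hp
    (by linarith) (by linarith)
  set B : ℝ≥0∞ := (1 + n + n * n + 1) * (L * D) with hB_def
  have hB : B ≠ ∞ := by finiteness
  refine ⟨(K.toReal + 1)⁻¹, B.toReal + 1, by positivity, by positivity, fun f => ⟨?_, ?_⟩⟩
  · set R := pbNorm m (α - 2) p T ⇑f
            + ∑ k : Fin n, pbNorm m (α - 2) p T (dX k ⇑f)
            + ∑ k : Fin n, ∑ j : Fin n, pbNorm m (α - 2) p T (dX k (dX j ⇑f))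
            + pbNorm m (α - 2) p T (dT ⇑f) with hR
    have hlow := fun g : SchwartzMap (Rn1 n) ℂ => besovTermsLE_pbNorm m (α - 2) p T g
    simp only [hb] at hlow
    have hterms : BesovTermsLE (m + 1) (α - 2 * ((m + 1 : ℕ) : ℝ)) p T f R := by
      refine .of_derivatives ((hlow f).mono ?_) (fun k => (hlow (schwartzDX k f)).mono ?_)
        (fun k j => (hlow (schwartzDX k (schwartzDX j f))).mono ?_)
        ((hlow (schwartzDT f)).mono le_add_self)
      · exact le_self_add.trans (le_self_add.trans le_self_add)
      · refine le_trans ?_ (le_add_self.trans (le_self_add.trans le_self_add))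
        exact Finset.single_le_sum (f := fun k => pbNorm m (α - 2) p T (dX k ⇑f))
          (fun _ _ => zero_le) (Finset.mem_univ k)
      · refine le_trans ?_ (le_add_self.trans le_self_add)
        refine le_trans ?_ (Finset.single_le_sum (fun _ _ => zero_le) (Finset.mem_univ k))
        exact Finset.single_le_sum (f := fun j => pbNorm m (α - 2) p T (dX k (dX j ⇑f)))
          (fun _ _ => zero_le) (Finset.mem_univ j)
    have hKR : K ≤ ENNReal.ofReal (K.toReal + 1) := by
      rw [ENNReal.le_ofReal_iff_toReal_le hK (by positivity)]
      linarith
    rw [ENNReal.ofReal_inv_of_pos (by positivity)]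
    calc _ ≤ (ENNReal.ofReal (K.toReal + 1))⁻¹ * (ENNReal.ofReal (K.toReal + 1) * R) := by
          gcongr
          exact (hle α p T f R hterms).trans (by gcongr)
      _ = R := ENNReal.inv_mul_cancel_left (by simp; positivity) ENNReal.ofReal_ne_top
  · set Q := pbNorm (m + 1) α p T ⇑f
    obtain ⟨h0, h1, h2, hT'⟩ := hsucc m f Q (besovTermsLE_pbNorm (m + 1) α p T f)
    have hup : ∀ g : SchwartzMap (Rn1 n) ℂ,
        BesovTermsLE m (α - 2 * ((m + 1 : ℕ) : ℝ)) p T g (D * Q) →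
        pbNorm m (α - 2) p T g ≤ L * (D * Q) := fun g hg =>
      hle' (α - 2) p T g (D * Q) (by rwa [hb])
    calc _ ≤ L * (D * Q) + ∑ _k : Fin n, L * (D * Q) + ∑ _k : Fin n, ∑ _j : Fin n, L * (D * Q)
          + L * (D * Q) :=
          add_le_add (add_le_add (add_le_add (hup f h0)
            (Finset.sum_le_sum fun k _ => hup (schwartzDX k f) (h1 k)))
            (Finset.sum_le_sum fun k _ => Finset.sum_le_sum fun j _ =>
              hup (schwartzDX k (schwartzDX j f)) (h2 k j))) (hup (schwartzDT f) hT')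
      _ = B * Q := by
          simp only [Finset.sum_const, Finset.card_univ, Fintype.card_fin, nsmul_eq_mul, hB_def]
          ring
      _ ≤ ENNReal.ofReal (B.toReal + 1) * Q := by
          gcongr
          rw [ENNReal.le_ofReal_iff_toReal_le hB (by positivity)]
          linarith
end
end

section
/- Let n ≥ 1 and let Φ be a Schwartz function on ℝⁿ whose Fourier transform is supported in the annulus {ξ : 1/4 ≤ |ξ| ≤ 4}. For every 1 ≤ p ≤ ∞ there exist constants C, c > 0 (depending only on n, p, Φ) such that for every integer i, every t > 0 and every Schwartz function f on ℝⁿ: ‖𝓕⁻¹( 𝓕Φ(2^{−i}ξ)·e^{−t|ξ|²}·𝓕f(ξ) )‖_{Lᵖ(ℝⁿ)} ≤ C·e^{−c·t·2^{2i}}·‖f‖_{Lᵖ(ℝⁿ)}. -/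
noncomputable section

open MeasureTheory Real Complex
open scoped ENNReal NNReal Real BigOperators

open scoped FourierTransform SchwartzMap Convolution ContDiff

section Young

variable {E : Type*} [NormedAddCommGroup E] [MeasurableSpace E] [BorelSpace E]
  [SecondCountableTopology E] {μ : Measure E} [SFinite μ] [μ.IsAddHaarMeasure]

/-- Young's inequality `‖k ⋆ f‖_p ≤ ‖k‖₁ ‖f‖_p`, for scalar functions. -/
theorem eLpNorm_convolution_mul_le {k f : E → ℂ} (hk : Integrable k μ)
    (hf : AEStronglyMeasurable f μ) {p : ℝ≥0∞} (hp : 1 ≤ p) :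
    eLpNorm (k ⋆[ContinuousLinearMap.mul ℂ ℂ, μ] f) p μ ≤ eLpNorm k 1 μ * eLpNorm f p μ := by
  have hbd : ∀ x, ‖(k ⋆[ContinuousLinearMap.mul ℂ ℂ, μ] f) x‖ₑ ≤
      ∫⁻ t, ‖k t‖ₑ * ‖f (x - t)‖ₑ ∂μ := by
    intro x
    refine (enorm_integral_le_lintegral_enorm _).trans_eq ?_
    simp [enorm_mul]
  have hfx : ∀ x, AEStronglyMeasurable (fun t => f (x - t)) μ := fun x =>
    hf.comp_quasiMeasurePreserving (quasiMeasurePreserving_sub_left μ x)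
  rcases eq_or_ne p ⊤ with rfl | hp'
  · rw [eLpNorm_exponent_top, eLpNorm_one_eq_lintegral_enorm, eLpNorm_exponent_top]
    refine essSup_le_of_ae_le _ (Filter.Eventually.of_forall fun x => (hbd x).trans ?_)
    rw [← lintegral_mul_const'' _ hk.aestronglyMeasurable.enorm]
    refine lintegral_mono_ae ?_
    filter_upwards [(quasiMeasurePreserving_sub_left μ x).ae
      (ae_le_eLpNormEssSup (f := f) (μ := μ))] with t ht
    gcongr
  have hp0 : p ≠ 0 := (zero_lt_one.trans_le hp).ne'
  set r : ℝ := p.toReal with hr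
  have hr0 : 0 < r := ENNReal.toReal_pos hp0 hp'
  set K : ℝ≥0∞ := ∫⁻ t, ‖k t‖ₑ ∂μ with hK
  have hKtop : K ≠ ⊤ := hk.2.ne
  have hKpow : K ^ (r - 1) ≠ ⊤ := by
    refine ENNReal.rpow_ne_top_of_nonneg ?_ hKtop
    have := (ENNReal.toReal_le_toReal ENNReal.one_ne_top hp').2 hp
    rw [ENNReal.toReal_one] at this
    linarith
  let ν := μ.withDensity fun t => ‖k t‖ₑ
  have hν : ν ≪ μ := withDensity_absolutelyContinuous _ _
  have hpt : ∀ x, ‖(k ⋆[ContinuousLinearMap.mul ℂ ℂ, μ] f) x‖ₑ ^ r ≤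
      (∫⁻ t, ‖k t‖ₑ * ‖f (x - t)‖ₑ ^ r ∂μ) * K ^ (r - 1) := by
    intro x
    have h := eLpNorm_le_eLpNorm_mul_rpow_measure_univ hp ((hfx x).mono_ac hν)
    rw [eLpNorm_one_eq_lintegral_enorm, eLpNorm_eq_lintegral_rpow_enorm_toReal hp0 hp',
      lintegral_withDensity_eq_lintegral_mul₀ hk.aestronglyMeasurable.enorm (hfx x).enorm,
      lintegral_withDensity_eq_lintegral_mul₀ hk.aestronglyMeasurable.enorm
        ((hfx x).enorm.pow_const _), withDensity_apply _ MeasurableSet.univ,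
      Measure.restrict_univ, ← hr, ← hK] at h
    calc _ ≤ (∫⁻ t, ‖k t‖ₑ * ‖f (x - t)‖ₑ ∂μ) ^ r := by gcongr; exact hbd x
      _ ≤ _ := ENNReal.rpow_le_rpow h hr0.le
      _ = _ := by
        rw [ENNReal.mul_rpow_of_nonneg _ _ hr0.le, ← ENNReal.rpow_mul, ← ENNReal.rpow_mul,
          one_div_mul_cancel hr0.ne', ENNReal.rpow_one]
        congr 2
        simp
        field_simp
  have hint : ∫⁻ x, ‖(k ⋆[ContinuousLinearMap.mul ℂ ℂ, μ] f) x‖ₑ ^ r ∂μ ≤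
      K ^ r * ∫⁻ x, ‖f x‖ₑ ^ r ∂μ := by
    calc _ ≤ ∫⁻ x, (∫⁻ t, ‖k t‖ₑ * ‖f (x - t)‖ₑ ^ r ∂μ) * K ^ (r - 1) ∂μ := lintegral_mono hpt
      _ = (∫⁻ x, ∫⁻ t, ‖k t‖ₑ * ‖f (x - t)‖ₑ ^ r ∂μ ∂μ) * K ^ (r - 1) :=
        lintegral_mul_const' _ _ hKpow
      _ = (∫⁻ t, ∫⁻ x, ‖k t‖ₑ * ‖f (x - t)‖ₑ ^ r ∂μ ∂μ) * K ^ (r - 1) := by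
        rw [lintegral_lintegral_swap]
        exact (hk.aestronglyMeasurable.comp_quasiMeasurePreserving
          Measure.quasiMeasurePreserving_snd).enorm.mul
          ((hf.comp_quasiMeasurePreserving (quasiMeasurePreserving_sub μ μ)).enorm.pow_const r)
      _ = (K * ∫⁻ x, ‖f x‖ₑ ^ r ∂μ) * K ^ (r - 1) := by
        congr 1
        rw [hK, ← lintegral_mul_const'' _ hk.aestronglyMeasurable.enorm]
        congr 1 with t
        rw [lintegral_const_mul' _ _ enorm_ne_top,
          lintegral_sub_right_eq_self (fun x => ‖f x‖ₑ ^ r)]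
      _ = _ := by
        rw [mul_right_comm]
        congr 1
        rcases eq_or_ne K 0 with h0 | h0
        · simp [h0, hr0]
        · nth_rewrite 1 [← ENNReal.rpow_one K]
          rw [← ENNReal.rpow_add _ _ h0 hKtop]
          congr 1
          ring
  rw [eLpNorm_one_eq_lintegral_enorm, eLpNorm_eq_lintegral_rpow_enorm_toReal hp0 hp',
    eLpNorm_eq_lintegral_rpow_enorm_toReal hp0 hp', ← hr, ← hK]
  refine (ENNReal.rpow_le_rpow hint (by positivity)).trans_eq ?_
  rw [ENNReal.mul_rpow_of_nonneg _ _ (by positivity), ← ENNReal.rpow_mul,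
    mul_one_div_cancel hr0.ne', ENNReal.rpow_one]

end Young

section Decay

variable {E : Type*} [NormedAddCommGroup E] [InnerProductSpace ℝ E]

theorem norm_iteratedFDeriv_ofReal_exp (i : ℕ) (x : ℝ) :
    ‖iteratedFDeriv ℝ i (fun y : ℝ => ((rexp y : ℝ) : ℂ)) x‖ = rexp x := by
  have h := Complex.ofRealLI.norm_iteratedFDeriv_comp_left (f := rexp) (x := x) (n := ∞)
    Real.contDiff_exp.contDiffAt (i := i) (by exact_mod_cast le_top)
  change ‖iteratedFDeriv ℝ i (Complex.ofRealLI ∘ rexp) x‖ = _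
  rw [h, norm_iteratedFDeriv_eq_norm_iteratedDeriv, iteratedDeriv_eq_iterate,
    Real.iter_deriv_exp, Real.norm_eq_abs, abs_of_pos (Real.exp_pos x)]

theorem one_add_pow_le_exp {s : ℝ} (hs : 0 ≤ s) (i : ℕ) :
    (1 + s) ^ i ≤ 32 ^ i * i.factorial * rexp 1 * rexp (s / 32) := by
  have h := Real.pow_div_factorial_le_exp ((1 + s) / 32) (by positivity) i
  rw [div_le_iff₀ (by positivity), div_pow, div_le_iff₀ (by positivity)] at h
  have h2 : rexp ((1 + s) / 32) ≤ rexp 1 * rexp (s / 32) := by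
    rw [← Real.exp_add]
    exact Real.exp_le_exp.2 (by linarith)
  calc _ ≤ _ := h
    _ ≤ rexp 1 * rexp (s / 32) * i.factorial * 32 ^ i := by gcongr
    _ = _ := by ring

variable (E) in
/-- On the annulus `1/4 ≤ |x| ≤ 4`, the derivatives of `e^{-s|x|²}` decay exponentially in `s`. -/
theorem exists_norm_iteratedFDeriv_gaussian_le [FiniteDimensional ℝ E] (i : ℕ) :
    ∃ C : ℝ, 0 ≤ C ∧ ∀ s : ℝ, 0 ≤ s → ∀ x : E, 1 / 4 ≤ ‖x‖ → ‖x‖ ≤ 4 →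
      ‖iteratedFDeriv ℝ i (fun y : E => ((rexp (-s * ‖y‖ ^ 2) : ℝ) : ℂ)) x‖ ≤
        C * rexp (-(s / 32)) := by
  have hq : ContDiff ℝ ∞ (fun y : E => ‖y‖ ^ 2) := contDiff_norm_sq ℝ
  have hB : ∀ j : ℕ, ∃ B : ℝ, ∀ x : E, ‖x‖ ≤ 4 →
      ‖iteratedFDeriv ℝ j (fun y : E => ‖y‖ ^ 2) x‖ ≤ B := by
    intro j
    obtain ⟨B, hB⟩ := (isCompact_closedBall (0 : E) 4).exists_bound_of_continuousOn
      (hq.continuous_iteratedFDeriv (m := j) (by exact_mod_cast le_top)).continuousOn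
    exact ⟨B, fun x hx => hB x (by simpa using hx)⟩
  choose B hB using hB
  set D : ℝ := 1 + ∑ j ∈ Finset.range (i + 1), |B j| with hD
  have hD1 : 1 ≤ D := by
    have : 0 ≤ ∑ j ∈ Finset.range (i + 1), |B j| := Finset.sum_nonneg fun j _ => abs_nonneg _
    linarith
  have hBD : ∀ j ≤ i, B j ≤ D := by
    intro j hj
    have := Finset.single_le_sum (f := fun j => |B j|) (fun j _ => abs_nonneg _)
      (Finset.mem_range.2 (Nat.lt_succ_of_le hj))
    linarith [le_abs_self (B j)]
  refine ⟨i.factorial * D ^ i * (32 ^ i * i.factorial * rexp 1), by positivity, ?_⟩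
  intro s hs x hx1 hx2
  have hcomp := norm_iteratedFDeriv_comp_le (𝕜 := ℝ) (n := i) (N := ∞)
    (g := fun y : ℝ => ((rexp y : ℝ) : ℂ)) (f := fun y : E => -s * ‖y‖ ^ 2)
    (Complex.ofRealCLM.contDiff.comp Real.contDiff_exp) (contDiff_const.mul hq)
    (by exact_mod_cast le_top) x (C := rexp (-(s / 16))) (D := D * (1 + s)) ?_ ?_
  · refine hcomp.trans ?_
    rw [mul_pow]
    have hexp : rexp (-(s / 16)) * rexp (s / 32) = rexp (-(s / 32)) := by
      rw [← Real.exp_add]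
      ring_nf
    calc _ ≤ i.factorial * rexp (-(s / 16)) *
          (D ^ i * (32 ^ i * i.factorial * rexp 1 * rexp (s / 32))) := by
            gcongr
            exact one_add_pow_le_exp hs i
      _ = i.factorial * D ^ i * (32 ^ i * i.factorial * rexp 1) *
          (rexp (-(s / 16)) * rexp (s / 32)) := by ring
      _ = _ := by rw [hexp]
  · intro j _
    rw [norm_iteratedFDeriv_ofReal_exp]
    refine Real.exp_le_exp.2 ?_
    have : (1 / 4 : ℝ) ^ 2 ≤ ‖x‖ ^ 2 := by gcongr
    nlinarith
  · intro j hj1 hj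
    have h : iteratedFDeriv ℝ j ((-s) • fun y : E => ‖y‖ ^ 2) x =
        (-s) • iteratedFDeriv ℝ j (fun y : E => ‖y‖ ^ 2) x :=
      iteratedFDeriv_const_smul_apply ((hq.of_le (by exact_mod_cast le_top)).contDiffAt)
    change ‖iteratedFDeriv ℝ j ((-s) • fun y : E => ‖y‖ ^ 2) x‖ ≤ _
    rw [h, norm_smul, norm_neg, Real.norm_of_nonneg hs]
    calc _ ≤ (1 + s) * D := by
          gcongr
          · linarith
          · exact (hB j x hx2).trans (hBD j hj)
      _ = D * (1 + s) := mul_comm _ _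
      _ ≤ _ := le_self_pow₀ (one_le_mul_of_one_le_of_one_le hD1 (by linarith)) (by omega)

/-- Multiplying an annularly supported Schwartz function by `e^{-s|x|²}` yields Schwartz functions
all of whose seminorms decay exponentially in `s`. -/
theorem SchwartzMap.exists_mul_gaussian_seminorm_le [FiniteDimensional ℝ E] (φ : 𝓢(E, ℂ))
    (hφ : ∀ x, φ x ≠ 0 → 1 / 4 ≤ ‖x‖ ∧ ‖x‖ ≤ 4) :
    ∃ g : ℝ → 𝓢(E, ℂ), (∀ s x, g s x = φ x * ((rexp (-s * ‖x‖ ^ 2) : ℝ) : ℂ)) ∧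
      ∀ k l : ℕ, ∃ C : ℝ, 0 ≤ C ∧ ∀ s, 0 ≤ s →
        SchwartzMap.seminorm ℝ k l (g s) ≤ C * rexp (-(s / 32)) := by
  have hts : tsupport φ ⊆ {x | 1 / 4 ≤ ‖x‖ ∧ ‖x‖ ≤ 4} :=
    closure_minimal hφ ((isClosed_le continuous_const continuous_norm).inter
      (isClosed_le continuous_norm continuous_const))
  have hcs : HasCompactSupport φ :=
    HasCompactSupport.of_support_subset_isCompact (isCompact_closedBall (0 : E) 4)
      fun x hx => by simpa using (hφ x hx).2
  have hexp : ∀ s : ℝ, ContDiff ℝ ∞ (fun y : E => ((rexp (-s * ‖y‖ ^ 2) : ℝ) : ℂ)) := fun s =>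
    Complex.ofRealCLM.contDiff.comp (Real.contDiff_exp.comp
      (contDiff_const.mul (contDiff_norm_sq ℝ)))
  refine ⟨fun s => (hcs.mul_right (f' := fun y : E => ((rexp (-s * ‖y‖ ^ 2) : ℝ) : ℂ))
    ).toSchwartzMap ((φ.smooth ⊤).mul (hexp s)), fun s x => rfl, ?_⟩
  intro k l
  choose C hC0 hC using exists_norm_iteratedFDeriv_gaussian_le E
  refine ⟨∑ i ∈ Finset.range (l + 1), 4 ^ k * ((l.choose i : ℝ) *
    SchwartzMap.seminorm ℝ 0 i φ * C (l - i)), ?_, ?_⟩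
  · exact Finset.sum_nonneg fun i _ => mul_nonneg (by positivity) (mul_nonneg
      (mul_nonneg (by positivity) (apply_nonneg _ _)) (hC0 _))
  intro s hs
  refine SchwartzMap.seminorm_le_bound ℝ k l _ ?_ ?_
  · exact mul_nonneg (Finset.sum_nonneg fun i _ => mul_nonneg (by positivity) (mul_nonneg
      (mul_nonneg (by positivity) (apply_nonneg _ _)) (hC0 _))) (Real.exp_pos _).le
  intro x
  have hmul := norm_iteratedFDeriv_mul_le (𝕜 := ℝ) (φ.smooth ⊤) (hexp s) x (n := l)
    (by exact_mod_cast le_top)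
  change ‖x‖ ^ k * ‖iteratedFDeriv ℝ l
    (fun y => φ y * ((rexp (-s * ‖y‖ ^ 2) : ℝ) : ℂ)) x‖ ≤ _
  refine (mul_le_mul_of_nonneg_left hmul (by positivity)).trans ?_
  rw [Finset.mul_sum, Finset.sum_mul]
  refine Finset.sum_le_sum fun i _ => ?_
  by_cases hx : x ∈ tsupport φ
  · obtain ⟨hx1, hx2⟩ := hts hx
    have h1 := SchwartzMap.le_seminorm ℝ 0 i φ x
    rw [pow_zero, one_mul] at h1
    have h2 := hC (l - i) s hs x hx1 hx2
    calc _ ≤ 4 ^ k * ((l.choose i : ℝ) * SchwartzMap.seminorm ℝ 0 i φ *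
          (C (l - i) * rexp (-(s / 32)))) := by gcongr
      _ = _ := by ring
  · have h0 : iteratedFDeriv ℝ i φ x = 0 :=
      image_eq_zero_of_notMem_tsupport fun h => hx (tsupport_iteratedFDeriv_subset i h)
    rw [h0, norm_zero, mul_zero, zero_mul, mul_zero]
    exact mul_nonneg (mul_nonneg (by positivity) (mul_nonneg
      (mul_nonneg (by positivity) (apply_nonneg _ _)) (hC0 _))) (Real.exp_pos _).le

end Decay

section Multiplier

variable {E : Type*} [NormedAddCommGroup E] [InnerProductSpace ℝ E] [FiniteDimensional ℝ E]
  [MeasurableSpace E] [BorelSpace E]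

/-- The `L¹` norm of the inverse Fourier transform is controlled by Schwartz seminorms. -/
theorem SchwartzMap.exists_eLpNorm_one_fourierInv_le {g : ℝ → 𝓢(E, ℂ)} {c : ℝ → ℝ}
    (hc : ∀ s, 0 ≤ s → 0 ≤ c s)
    (hg : ∀ k l : ℕ, ∃ C : ℝ, 0 ≤ C ∧ ∀ s, 0 ≤ s → SchwartzMap.seminorm ℝ k l (g s) ≤ C * c s) :
    ∃ C : ℝ, 0 < C ∧ ∀ s, 0 ≤ s →
      eLpNorm (𝓕⁻ (g s) : 𝓢(E, ℂ)) 1 volume ≤ ENNReal.ofReal (C * c s) := by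
  let L : 𝓢(E, ℂ) →L[ℝ] Lp ℂ 1 (volume : Measure E) :=
    SchwartzMap.toLpCLM ℝ ℂ 1 volume ∘L FourierTransform.fourierInvCLM ℝ 𝓢(E, ℂ)
  let q : Seminorm ℝ 𝓢(E, ℂ) := (normSeminorm ℝ (Lp ℂ 1 (volume : Measure E))).comp L.toLinearMap
  obtain ⟨S, A, -, hq⟩ := Seminorm.bound_of_continuous (schwartz_withSeminorms ℝ E ℂ) q
    (continuous_norm.comp L.continuous)
  choose C hC0 hC using hg
  have hS : 0 ≤ ∑ m ∈ S, C m.1 m.2 := Finset.sum_nonneg fun m _ => hC0 _ _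
  refine ⟨A * (∑ m ∈ S, C m.1 m.2) + 1, by positivity, fun s hs => ?_⟩
  have hcs := hc s hs
  have h1 : q (g s) ≤ A * ((∑ m ∈ S, C m.1 m.2) * c s) := by
    refine (hq (g s)).trans ?_
    rw [smul_apply, NNReal.smul_def, smul_eq_mul]
    refine mul_le_mul_of_nonneg_left ?_ A.2
    refine Seminorm.finset_sup_apply_le (by positivity) fun m hm => (hC m.1 m.2 s hs).trans ?_
    gcongr
    exact Finset.single_le_sum (f := fun m : ℕ × ℕ => C m.1 m.2) (fun m _ => hC0 _ _) hm
  have h2 : q (g s) = (eLpNorm (𝓕⁻ (g s) : 𝓢(E, ℂ)) 1 volume).toReal :=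
    SchwartzMap.norm_toLp (f := 𝓕⁻ (g s))
  rw [← ENNReal.ofReal_toReal ((𝓕⁻ (g s) : 𝓢(E, ℂ)).memLp 1 volume).2.ne, ← h2]
  refine ENNReal.ofReal_le_ofReal (h1.trans ?_)
  nlinarith

/-- The inverse Fourier transform of a dilation. -/
theorem Real.fourierInv_comp_smul (g : E → ℂ) {a : ℝ} (ha : a ≠ 0) (x : E) :
    𝓕⁻ (fun v => g (a • v)) x = |(a ^ Module.finrank ℝ E)⁻¹| • 𝓕⁻ g (a⁻¹ • x) := by
  rw [Real.fourierInv_eq', Real.fourierInv_eq',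
    ← Measure.integral_comp_smul volume
      (fun v : E => cexp (↑(2 * π * inner ℝ v (a⁻¹ • x)) * I) • g v) a]
  congr 1 with v
  rw [real_inner_smul_left, real_inner_smul_right, mul_inv_cancel_left₀ ha]

theorem SchwartzMap.eLpNorm_one_fourierInv_dilation (g h : 𝓢(E, ℂ)) {a : ℝ} (ha : a ≠ 0)
    (hgh : ∀ x, h x = g (a • x)) :
    eLpNorm (𝓕⁻ h : 𝓢(E, ℂ)) 1 volume = eLpNorm (𝓕⁻ g : 𝓢(E, ℂ)) 1 volume := by
  have hh : ∀ x, (𝓕⁻ h : 𝓢(E, ℂ)) x =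
      |(a ^ Module.finrank ℝ E)⁻¹| • (𝓕⁻ g : 𝓢(E, ℂ)) (a⁻¹ • x) := by
    intro x
    rw [SchwartzMap.fourierInv_coe, SchwartzMap.fourierInv_coe, ← Real.fourierInv_comp_smul _ ha,
      funext hgh]
  rw [eLpNorm_one_eq_lintegral_enorm, eLpNorm_one_eq_lintegral_enorm,
    ← ofReal_integral_norm_eq_lintegral_enorm (SchwartzMap.integrable _),
    ← ofReal_integral_norm_eq_lintegral_enorm (SchwartzMap.integrable _)]
  congr 1
  simp_rw [hh, norm_smul]
  rw [integral_const_mul,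
    Measure.integral_comp_smul volume (fun x => ‖(𝓕⁻ g : 𝓢(E, ℂ)) x‖) a⁻¹, smul_eq_mul,
    ← mul_assoc, Real.norm_eq_abs, abs_abs, ← abs_mul, inv_pow, inv_inv,
    inv_mul_cancel₀ (pow_ne_zero _ ha), abs_one, one_mul]

/-- A Fourier multiplier with Schwartz symbol `m` is bounded on `Lᵖ` with norm at most
`‖𝓕⁻¹ m‖₁`. -/
theorem SchwartzMap.eLpNorm_fourierInv_mul_fourier_le (m f : 𝓢(E, ℂ)) {p : ℝ≥0∞} (hp : 1 ≤ p) :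
    eLpNorm (𝓕⁻ fun ξ => m ξ * 𝓕 (f : E → ℂ) ξ) p volume ≤
      eLpNorm (𝓕⁻ m : 𝓢(E, ℂ)) 1 volume * eLpNorm f p volume := by
  have h : (𝓕⁻ fun ξ => m ξ * 𝓕 (f : E → ℂ) ξ) =
      (𝓕⁻ m : 𝓢(E, ℂ)) ⋆[ContinuousLinearMap.mul ℂ ℂ, volume] f := by
    ext x
    rw [← SchwartzMap.convolution_apply]
    have h1 : SchwartzMap.convolution (ContinuousLinearMap.mul ℂ ℂ) (𝓕⁻ m) f =
        𝓕⁻ (SchwartzMap.pairing (ContinuousLinearMap.mul ℂ ℂ) m (𝓕 f)) := by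
      have h2 : 𝓕 (SchwartzMap.convolution (ContinuousLinearMap.mul ℂ ℂ) (𝓕⁻ m) f) =
          SchwartzMap.pairing (ContinuousLinearMap.mul ℂ ℂ) m (𝓕 f) := by
        rw [SchwartzMap.fourier_convolution, FourierTransform.fourier_fourierInv_eq]
      rw [← h2, FourierTransform.fourierInv_fourier_eq]
    rw [h1, SchwartzMap.fourierInv_coe]
    rfl
  rw [h]
  exact eLpNorm_convolution_mul_le (SchwartzMap.integrable _)
    f.continuous.aestronglyMeasurable hp

end Multiplier

theorem FTn_eq_fourier {n : ℕ} (f : Rn n → ℂ) : FTn f = 𝓕 f := by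
  ext ξ
  rw [Real.fourier_eq', FTn]
  congr 1 with x
  rw [smul_eq_mul]
  congr 2
  simp only [PiLp.inner_apply, RCLike.inner_apply, conj_trivial]
  push_cast
  simp_rw [mul_comm (ξ _ : ℂ)]
  ring

theorem IFTn_eq_fourierInv {n : ℕ} (f : Rn n → ℂ) : IFTn f = 𝓕⁻ f := by
  ext x
  rw [Real.fourierInv_eq', IFTn]
  congr 1 with ξ
  rw [smul_eq_mul]
  congr 2
  simp only [PiLp.inner_apply, RCLike.inner_apply, conj_trivial]
  push_cast
  simp_rw [mul_comm (x _ : ℂ)]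
  ring

/-- Heat-semigroup multiplier estimate on a dyadic annulus:
`‖𝓕⁻¹(𝓕Φ(2^{−i}ξ)e^{−t|ξ|²}𝓕f)‖_p ≤ C e^{−c t 2^{2i}} ‖f‖_p`. -/
theorem stmt13 (n : ℕ) (hn : 1 ≤ n) (Φ : SchwartzMap (Rn n) ℂ)
    (hΦ : ∀ ξ : Rn n, FTn (⇑Φ) ξ ≠ 0 → 1 / 4 ≤ ‖ξ‖ ∧ ‖ξ‖ ≤ 4)
    (p : ℝ≥0∞) (hp : 1 ≤ p) :
    ∃ C c : ℝ, 0 < C ∧ 0 < c ∧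
      ∀ (i : ℤ) (t : ℝ), 0 < t → ∀ f : SchwartzMap (Rn n) ℂ,
        eLpNorm (IFTn (fun ξ => FTn (⇑Φ) (((2 : ℝ) ^ (-i)) • ξ) *
            ((Real.exp (-t * ‖ξ‖ ^ 2) : ℝ) : ℂ) * FTn (⇑f) ξ)) p volume
          ≤ ENNReal.ofReal (C * Real.exp (-(c * t * (2 : ℝ) ^ (2 * i)))) *
            eLpNorm (⇑f) p volume := by
  simp_rw [FTn_eq_fourier, IFTn_eq_fourierInv] at hΦ ⊢
  obtain ⟨g, hg, hgs⟩ := SchwartzMap.exists_mul_gaussian_seminorm_le (𝓕 Φ) hΦ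
  obtain ⟨C, hC, hle⟩ := SchwartzMap.exists_eLpNorm_one_fourierInv_le
    (fun s _ => (Real.exp_pos (-(s / 32))).le) hgs
  refine ⟨C, 1 / 32, hC, by norm_num, fun i t ht f => ?_⟩
  have ha : (2 : ℝ) ^ (-i) ≠ 0 := by positivity
  set s : ℝ := t * (2 : ℝ) ^ (2 * i) with hs
  let m : 𝓢(Rn n, ℂ) := SchwartzMap.compCLMOfContinuousLinearEquiv ℂ
    (ContinuousLinearEquiv.smulLeft (R₁ := ℝ) (Units.mk0 ((2 : ℝ) ^ (-i)) ha)) (g s)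
  have hm : ∀ ξ, m ξ = g s ((2 : ℝ) ^ (-i) • ξ) := fun ξ => rfl
  have hsymb : ∀ ξ, m ξ = 𝓕 (Φ : Rn n → ℂ) ((2 : ℝ) ^ (-i) • ξ) *
      ((Real.exp (-t * ‖ξ‖ ^ 2) : ℝ) : ℂ) := by
    intro ξ
    have h2 : (2 : ℝ) ^ (2 * i) * ((2 : ℝ) ^ (-i)) ^ 2 = 1 := by
      rw [← zpow_natCast, ← zpow_mul, ← zpow_add₀ two_ne_zero]
      norm_num
      ring_nf
      norm_num
    have h3 : -s * ‖(2 : ℝ) ^ (-i) • ξ‖ ^ 2 = -t * ‖ξ‖ ^ 2 := by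
      rw [norm_smul, Real.norm_of_nonneg (by positivity), mul_pow, hs]
      linear_combination (-t * ‖ξ‖ ^ 2) * h2
    rw [hm, hg, h3]
    rfl
  simp_rw [← hsymb]
  refine (m.eLpNorm_fourierInv_mul_fourier_le f hp).trans ?_
  gcongr
  rw [SchwartzMap.eLpNorm_one_fourierInv_dilation (g s) m ha hm]
  refine (hle s (by positivity)).trans_eq ?_
  rw [hs]
  ring_nf
end
end
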